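/- arXiv:2510.04505 — 2 statements merged into one kernel-verified Lean document; each statement's English description precedes it below -/
import Mathlib

section
/- Assume conditions (C_g)(a) (with d > c > 0) and (C_{f_n})(a)(b); fix κ⁺ ∈ (0, 1−ξ₁) and κ⁻ ∈ (−ξ₁, 0), and for large n let ξ_{1,n} be the unique positive zero of ξ ↦ −a_n·ξ + b_n·f_n(ξ) near ξ₁. Then, for all sufficiently large n, there exist unique solutions y^{−,n}, y^{+,n} : ℝ → ℝ of (E_{f_n}) on ℝ with the following properties: (i) y^{+,n} is strictly increasing on (−∞, 0], y^{+,n}(0) = κ⁺ + ξ_{1,n}, lim_{t→−∞} y^{+,n}(t) = ξ_{1,n}, and y^{+,n}(t) ∈ (0, 2d/c) for all t ∈ ℝ; (ii) y^{−,n} is strictly decreasing on ℝ with range (0, ξ_{1,n}), y^{−,n}(0) = κ⁻ + ξ_{1,n}, y^{−,n}(t) → ξ_{1,n} as t → −∞, and y^{−,n}(t) → 0 as t → ∞. -/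
open Real Set Filter Topology MeasureTheory

noncomputable section

/-- Condition `(C_g)(a)`: `g` maps `[0,∞)` into `[0,1]`, the restriction of `g` to `[0,1]`
is `C¹` with derivative `g'` (one-sided at the endpoints), `g = 0` on `(1,∞)`,
`g 0 = g' 0 = 0`, `g 1 = 1`, and `g' ξ > g ξ / ξ` for all `ξ ∈ (0,1]`. -/
structure CgA (g g' : ℝ → ℝ) : Prop where
  maps_to : ∀ ξ : ℝ, 0 ≤ ξ → g ξ ∈ Icc (0:ℝ) 1
  hasDeriv : ∀ ξ ∈ Icc (0:ℝ) 1, HasDerivWithinAt g (g' ξ) (Icc (0:ℝ) 1) ξ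
  derivCont : ContinuousOn g' (Icc (0:ℝ) 1)
  eq_zero : ∀ ξ : ℝ, 1 < ξ → g ξ = 0
  g_zero : g 0 = 0
  g'_zero : g' 0 = 0
  g_one : g 1 = 1
  slope : ∀ ξ : ℝ, 0 < ξ → ξ ≤ 1 → g ξ / ξ < g' ξ

/-- `x` is a (nonnegative, continuous) solution on `ℝ` of the delay equation
`x'(t) = -a·x(t) + b·F(x(t-1))`, in integral form. -/
def IsSolR (a b : ℝ) (F x : ℝ → ℝ) : Prop :=
  Continuous x ∧ (∀ t : ℝ, 0 ≤ x t) ∧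
    ∀ τ t : ℝ, τ < t →
      IntervalIntegrable (fun s => Real.exp (-a * (t - s)) * F (x (s - 1))) volume τ t ∧
      x t = Real.exp (-a * (t - τ)) * x τ
          + b * ∫ s in τ..t, Real.exp (-a * (t - s)) * F (x (s - 1))

/-- `x` is a (nonnegative, continuous) solution on `[T₁ - 1, ∞)` of the delay equation
`x'(t) = -a·x(t) + b·F(x(t-1))`, in integral form (identity for `T₁ ≤ τ < t`). -/
def IsSolOn (a b : ℝ) (F : ℝ → ℝ) (T₁ : ℝ) (x : ℝ → ℝ) : Prop :=
  ContinuousOn x (Ici (T₁ - 1)) ∧ (∀ t : ℝ, T₁ - 1 ≤ t → 0 ≤ x t) ∧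
    ∀ τ t : ℝ, T₁ ≤ τ → τ < t →
      IntervalIntegrable (fun s => Real.exp (-a * (t - s)) * F (x (s - 1))) volume τ t ∧
      x t = Real.exp (-a * (t - τ)) * x τ
          + b * ∫ s in τ..t, Real.exp (-a * (t - s)) * F (x (s - 1))

/-- `z` is the solution of `(E_g)` on `[0,∞)` with initial segment `z t = e^{-c t}` on `[0,1]`. -/
def IsZSol (c d : ℝ) (g z : ℝ → ℝ) : Prop :=
  IsSolOn c d g 1 z ∧ ∀ t ∈ Icc (0:ℝ) 1, z t = Real.exp (-c * t)

/-- Condition `(C_{f_n})(a)(b)`: `a n → c`, `b n → d`, each `f n : [0,∞) → [0,1)` is `C¹`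
with derivative `f' n`, `f n 0 = 0`, `f' n > 0` on `(0,1/2]`, the uniform closeness of
`(f n, f' n)` to `(g, g')` away from `1`, and the smallness of
`sup_{[1+κ,∞)}|f' n| · (sup_{[0,∞)}|f' n|)^m`. -/
structure Cfn (c d : ℝ) (g g' : ℝ → ℝ) (a b : ℕ → ℝ) (f f' : ℕ → ℝ → ℝ) : Prop where
  a_pos : ∀ n, 0 < a n
  b_pos : ∀ n, 0 < b n
  a_lim : Tendsto a atTop (nhds c)
  b_lim : Tendsto b atTop (nhds d)
  maps_to : ∀ n, ∀ ξ : ℝ, 0 ≤ ξ → f n ξ ∈ Ico (0:ℝ) 1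
  hasDeriv : ∀ n, ∀ ξ : ℝ, 0 ≤ ξ → HasDerivWithinAt (f n) (f' n ξ) (Ici (0:ℝ)) ξ
  derivCont : ∀ n, ContinuousOn (f' n) (Ici (0:ℝ))
  f_zero : ∀ n, f n 0 = 0
  f'_pos : ∀ n, ∀ ξ : ℝ, 0 < ξ → ξ ≤ 1/2 → 0 < f' n ξ
  close : ∀ κ : ℝ, 0 < κ → κ < 1 → ∀ ε : ℝ, 0 < ε → ∃ N : ℕ, ∀ n ≥ N,
      ∀ ξ : ℝ, (ξ ∈ Icc (0:ℝ) (1 - κ) ∨ 1 + κ ≤ ξ) →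
        |f n ξ - g ξ| + |f' n ξ - g' ξ| < ε
  small : ∀ κ : ℝ, 0 < κ → κ < 1 → ∀ m : ℕ, ∃ A B : ℕ → ℝ,
      (∀ n, ∀ ξ : ℝ, 1 + κ ≤ ξ → |f' n ξ| ≤ A n) ∧
      (∀ n, ∀ ξ : ℝ, 0 ≤ ξ → |f' n ξ| ≤ B n) ∧
      Tendsto (fun n => A n * (B n) ^ m) atTop (nhds 0)

/-- Condition `(H)`. -/
structure CondH (a b ξm ξp : ℝ) (h : ℝ → ℝ) : Prop where
  a_pos : 0 < a
  b_pos : 0 < b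
  ξm_neg : ξm < 0
  ξp_pos : 0 < ξp
  bdd : ∃ M : ℝ, ∀ ξ : ℝ, |h ξ| ≤ M
  smooth : ContDiff ℝ 1 h
  h_zero : h 0 = 0
  slope_zero : a < b * deriv h 0
  zero_m : -a * ξm + b * h ξm = 0
  zero_p : -a * ξp + b * h ξp = 0
  ratio : ∀ ξ : ℝ, ξm < ξ → ξ < ξp → ξ ≠ 0 → a / b < h ξ / ξ
  deriv_pos : ∀ ξ : ℝ, ξ ≠ ξm → ξ ≠ ξp → 0 < deriv h ξ

/-- Solution of `(E_h)`: `u'(t) = -a·u(t) + b·h(u(t-1))` on all of `ℝ`. -/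
def IsSolH (a b : ℝ) (h u : ℝ → ℝ) : Prop :=
  ∀ t : ℝ, HasDerivAt u (-a * u t + b * h (u (t - 1))) t

/-- Solution of `(E_h)` on `[-1,∞)`: continuous there, differentiable on `(0,∞)`
and satisfying the equation for `t > 0`. -/
def IsSolHOn (a b : ℝ) (h u : ℝ → ℝ) : Prop :=
  ContinuousOn u (Ici (-1:ℝ)) ∧
    ∀ t : ℝ, 0 < t → HasDerivAt u (-a * u t + b * h (u (t - 1))) t

/-- Solution of `(E_h)` on `(-∞,0]`. -/
def IsSolHIic (a b : ℝ) (h u : ℝ → ℝ) : Prop :=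
  ContinuousOn u (Iic (0:ℝ)) ∧
    ∀ t : ℝ, t ≤ 0 → HasDerivWithinAt u (-a * u t + b * h (u (t - 1))) (Iic (0:ℝ)) t

/-- Defining properties of `y^{+,n}` (statement (i) of the proposition). -/
def YPlusSpec (a b κp ξ M : ℝ) (f y : ℝ → ℝ) : Prop :=
  IsSolR a b f y ∧ StrictMonoOn y (Iic (0:ℝ)) ∧ y 0 = κp + ξ ∧
    Tendsto y atBot (nhds ξ) ∧ ∀ t : ℝ, y t ∈ Ioo (0:ℝ) M

/-- Defining properties of `y^{-,n}` (statement (ii) of the proposition). -/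
def YMinusSpec (a b κm ξ : ℝ) (f y : ℝ → ℝ) : Prop :=
  IsSolR a b f y ∧ StrictAnti y ∧ Set.range y = Ioo (0:ℝ) ξ ∧ y 0 = κm + ξ ∧
    Tendsto y atBot (nhds ξ) ∧ Tendsto y atTop (nhds 0)


def Sol (a b : ℝ) (H x : ℝ → ℝ) (J : Set ℝ) : Prop :=
  ∀ τ ∈ J, ∀ t ∈ J, τ ≤ t →
    Real.exp (a * t) * x t = Real.exp (a * τ) * x τ
      + b * ∫ s in τ..t, Real.exp (a * s) * H (x (s - 1))

lemma step_ind {P : ℝ → Prop} {τ T : ℝ} (h0 : ∀ t, t ≤ τ → P t)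
    (h : ∀ s, τ ≤ s → (∀ r, r ≤ s → r ≤ T → P r) → ∀ t, s ≤ t → t ≤ s + 1 → t ≤ T → P t) :
    ∀ t, t ≤ T → P t := by
  have key : ∀ k : ℕ, ∀ t, t ≤ τ + k → t ≤ T → P t := by
    intro k
    induction k with
    | zero => intro t ht _; exact h0 t (by simpa using ht)
    | succ k ih =>
      intro t ht hT
      by_cases hk : t ≤ τ + k
      · exact ih t hk hT
      · push_cast at ht
        exact h (τ + k) (by linarith [(Nat.cast_nonneg k : (0:ℝ) ≤ k)]) ih t (le_of_not_ge hk) (by linarith) hT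
  intro t ht
  obtain ⟨k, hk⟩ := exists_nat_ge (t - τ)
  exact key k t (by linarith) ht

lemma int_exp (a τ t : ℝ) (ha : a ≠ 0) :
    ∫ s in τ..t, Real.exp (a * s) = (Real.exp (a * t) - Real.exp (a * τ)) / a := by
  rw [intervalIntegral.integral_comp_mul_left (fun x => Real.exp x) ha, integral_exp]
  simp [div_eq_inv_mul]

lemma cont_int {a : ℝ} {H x : ℝ → ℝ} (hH : Continuous H) (hx : Continuous x) :
    Continuous (fun s => Real.exp (a * s) * H (x (s - 1))) := by
  fun_prop

lemma compare {a b T τ : ℝ} {H x y : ℝ → ℝ} (hb : 0 ≤ b) (hH : Continuous H) (hm : Monotone H)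
    (cx : Continuous x) (cy : Continuous y)
    (hx : ∀ t, τ ≤ t → t ≤ T → Real.exp (a * t) * x t ≤ Real.exp (a * τ) * x τ
      + b * ∫ s in τ..t, Real.exp (a * s) * H (x (s - 1)))
    (hy : ∀ t, τ ≤ t → t ≤ T → Real.exp (a * τ) * y τ
      + b * (∫ s in τ..t, Real.exp (a * s) * H (y (s - 1))) ≤ Real.exp (a * t) * y t)
    (h0 : ∀ t, τ - 1 ≤ t → t ≤ τ → x t ≤ y t) :
    (∀ t, τ - 1 ≤ t → t ≤ T → x t ≤ y t) ∧
    (∀ t, τ ≤ t → t ≤ T → Real.exp (a * τ) * (y τ - x τ) ≤ Real.exp (a * t) * (y t - x t)) := by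
  have aux : ∀ t, τ ≤ t → t ≤ T → (∀ s, τ - 1 ≤ s → s ≤ t - 1 → x s ≤ y s) →
      Real.exp (a * τ) * (y τ - x τ) ≤ Real.exp (a * t) * (y t - x t) := by
    intro t h1 h2 h3
    have h4 : ∫ s in τ..t, Real.exp (a * s) * H (x (s - 1)) ≤
        ∫ s in τ..t, Real.exp (a * s) * H (y (s - 1)) := by
      apply intervalIntegral.integral_mono_on h1 ((cont_int hH cx).intervalIntegrable _ _)
        ((cont_int hH cy).intervalIntegrable _ _)
      intro s hs
      have := hm (h3 (s - 1) (by linarith [hs.1]) (by linarith [hs.2]))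
      gcongr
    have h5 := mul_le_mul_of_nonneg_left h4 hb
    have := hx t h1 h2
    have := hy t h1 h2
    nlinarith
  have main : ∀ t, t ≤ T → (τ - 1 ≤ t → x t ≤ y t) := by
    apply step_ind (P := fun t => τ - 1 ≤ t → x t ≤ y t) (τ := τ) (T := T)
    · intro t ht h; exact h0 t h ht
    · intro s hs ih t h1 h2 h3 _
      have := aux t (by linarith) h3 (fun r hr hr' => ih r (by linarith) (by linarith) hr)
      have h6 := h0 τ (by linarith) le_rfl
      have h7 : 0 ≤ Real.exp (a * t) * (y t - x t) :=
        le_trans (mul_nonneg (Real.exp_pos _).le (by linarith)) this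
      have := nonneg_of_mul_nonneg_right h7 (Real.exp_pos _)
      linarith
  refine ⟨fun t h1 h2 => main t h2 h1, fun t h1 h2 => aux t h1 h2 fun s h3 h4 => main s (by linarith) h3⟩

lemma Sol.shift {a b T : ℝ} {H x : ℝ → ℝ} (h : Sol a b H x (Ici T)) (s : ℝ) :
    Sol a b H (fun t => x (t + s)) (Ici (T - s)) := by
  intro τ hτ t ht hle
  simp only [mem_Ici] at hτ ht
  have h1 := h (τ + s) (by simp; linarith) (t + s) (by simp; linarith) (by linarith)
  have h2 : ∫ r in τ + s..t + s, Real.exp (a * r) * H (x (r - 1)) =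
      Real.exp (a * s) * ∫ r in τ..t, Real.exp (a * r) * H (x (r - 1 + s)) := by
    rw [← intervalIntegral.integral_comp_add_right, ← intervalIntegral.integral_const_mul]
    congr 1; ext r
    rw [mul_add, Real.exp_add]
    rw [show r + s - 1 = r - 1 + s by ring]; ring
  rw [h2, mul_add, mul_add, Real.exp_add, Real.exp_add] at h1
  have h3 := Real.exp_pos (a * s)
  apply mul_left_cancel₀ h3.ne'
  simp only
  linear_combination h1

lemma Sol.mono {a b : ℝ} {H x : ℝ → ℝ} {J J' : Set ℝ} (h : Sol a b H x J) (hJ : J' ⊆ J) :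
    Sol a b H x J' := fun τ hτ t ht => h τ (hJ hτ) t (hJ ht)

lemma Sol.const_sub {a b C τ t : ℝ} {H : ℝ → ℝ} (ha : 0 < a) (h : a * C ≤ b * H C) (hle : τ ≤ t) :
    Real.exp (a * t) * C ≤ Real.exp (a * τ) * C
      + b * ∫ s in τ..t, Real.exp (a * s) * H C := by
  rw [intervalIntegral.integral_mul_const, int_exp _ _ _ ha.ne']
  have h1 : Real.exp (a * τ) ≤ Real.exp (a * t) := by gcongr
  have : b * ((Real.exp (a * t) - Real.exp (a * τ)) / a * H C) =
    (Real.exp (a * t) - Real.exp (a * τ)) * ((b * H C) / a) := by ring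
  rw [this]
  have : C ≤ b * H C / a := by rw [le_div_iff₀ ha]; linarith
  nlinarith

lemma Sol.const_super {a b C τ t : ℝ} {H : ℝ → ℝ} (ha : 0 < a) (h : b * H C ≤ a * C) (hle : τ ≤ t) :
    Real.exp (a * τ) * C
      + b * (∫ s in τ..t, Real.exp (a * s) * H C) ≤ Real.exp (a * t) * C := by
  rw [intervalIntegral.integral_mul_const, int_exp _ _ _ ha.ne']
  have h1 : Real.exp (a * τ) ≤ Real.exp (a * t) := by gcongr
  have : b * ((Real.exp (a * t) - Real.exp (a * τ)) / a * H C) =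
    (Real.exp (a * t) - Real.exp (a * τ)) * ((b * H C) / a) := by ring
  rw [this]
  have : b * H C / a ≤ C := by rw [div_le_iff₀ ha]; linarith
  nlinarith

/-- method of steps -/
lemma exists_ext {a b : ℝ} {F φ : ℝ → ℝ} (hF : Continuous F) (hφ : Continuous φ) :
    ∃ x : ℝ → ℝ, Continuous x ∧ (∀ t ≤ 0, x t = φ t) ∧ Sol a b F x (Ici 0) := by
  let S : (ℝ → ℝ) → ℝ → ℝ := fun x t =>
    φ (min t 0) + (Real.exp (- (a * max t 0)) * (φ 0 + b * ∫ s in (0:ℝ)..max t 0, Real.exp (a * s) * F (x (s - 1)))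
      - φ 0)
  let X : ℕ → ℝ → ℝ := fun k => S^[k] φ
  have XS : ∀ k, X (k+1) = S (X k) := fun k => Function.iterate_succ_apply' S k φ
  have Xc : ∀ k, Continuous (X k) := by
    intro k
    induction k with
    | zero => exact hφ
    | succ k ih =>
      rw [XS]
      have h1 : Continuous (fun t => ∫ s in (0:ℝ)..t, Real.exp (a * s) * F (X k (s - 1))) :=
        intervalIntegral.continuous_primitive
          (fun p q => (cont_int hF ih).intervalIntegrable p q) 0
      have h2 : Continuous (fun t : ℝ => ∫ s in (0:ℝ)..max t 0, Real.exp (a * s) * F (X k (s - 1))) :=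
        h1.comp (by fun_prop : Continuous (fun t : ℝ => max t 0))
      show Continuous (fun t => φ (min t 0) + (Real.exp (- (a * max t 0)) * (φ 0 + b * ∫ s in (0:ℝ)..max t 0, Real.exp (a * s) * F (X k (s - 1)))
      - φ 0))
      fun_prop
  have X0 : ∀ k, ∀ t ≤ 0, X k t = φ t := by
    intro k t ht
    cases k with
    | zero => rfl
    | succ k => rw [XS]; simp [S, ht]
  have Xstep : ∀ k : ℕ, ∀ t ≤ (k:ℝ), X (k+1) t = X k t := by
    intro k
    induction k with
    | zero => intro t ht; rw [X0 _ t (by simpa using ht), X0 _ t (by simpa using ht)]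
    | succ k ih =>
      intro t ht
      push_cast at ht
      have : ∫ s in (0:ℝ)..max t 0, Real.exp (a * s) * F (X (k+1) (s - 1)) =
        ∫ s in (0:ℝ)..max t 0, Real.exp (a * s) * F (X k (s - 1)) := by
        apply intervalIntegral.integral_congr
        intro s hs
        rw [uIcc_of_le (by simp)] at hs
        have h1 : s ≤ k + 1 := hs.2.trans (max_le ht (by positivity))
        simp only
        rw [ih (s - 1) (by linarith)]
      calc X (k+1+1) t = S (X (k+1)) t := by rw [XS (k+1)]
        _ = S (X k) t := by
          show φ (min t 0) + (Real.exp (- (a * max t 0)) * (φ 0 + b * ∫ s in (0:ℝ)..max t 0, Real.exp (a * s) * F (X (k+1) (s - 1))) - φ 0) = φ (min t 0) + (Real.exp (- (a * max t 0)) * (φ 0 + b * ∫ s in (0:ℝ)..max t 0, Real.exp (a * s) * F (X k (s - 1))) - φ 0)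
          rw [this]
        _ = X (k+1) t := by rw [XS k]
  have Xst : ∀ k j : ℕ, ∀ t ≤ (k:ℝ), X (k+j) t = X k t := by
    intro k j t ht
    induction j with
    | zero => rfl
    | succ j ih =>
      rw [← add_assoc, Xstep (k+j) t (by push_cast; linarith [(Nat.cast_nonneg j : (0:ℝ) ≤ j)]), ih]
  let x : ℝ → ℝ := fun t => X ⌈t⌉₊ t
  have xX : ∀ k : ℕ, ∀ t ≤ (k:ℝ), x t = X k t := by
    intro k t ht
    have : ⌈t⌉₊ ≤ k := Nat.ceil_le.2 ht
    obtain ⟨j, rfl⟩ := Nat.exists_eq_add_of_le this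
    exact (Xst _ j t (Nat.le_ceil t)).symm
  have xc : Continuous x := by
    rw [continuous_iff_continuousAt]
    intro t
    obtain ⟨k, hk⟩ := exists_nat_gt t
    refine (Xc k).continuousAt.congr ?_
    filter_upwards [Iio_mem_nhds hk] with s hs
    exact (xX k s (le_of_lt hs)).symm
  have xe : ∀ t, 0 ≤ t → Real.exp (a * t) * x t = φ 0 + b * ∫ s in (0:ℝ)..t, Real.exp (a * s) * F (x (s - 1)) := by
    intro t ht
    obtain ⟨k, hk⟩ := exists_nat_ge t
    rw [xX (k+1) t (by push_cast; linarith), XS]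
    simp only [S, max_eq_left ht, min_eq_right ht]
    have : ∫ s in (0:ℝ)..t, Real.exp (a * s) * F (X k (s - 1)) =
        ∫ s in (0:ℝ)..t, Real.exp (a * s) * F (x (s - 1)) := by
      apply intervalIntegral.integral_congr
      intro s hs
      rw [uIcc_of_le ht] at hs
      simp only
      rw [xX k (s - 1) (by linarith [hs.2])]
    rw [this]
    have h2 : Real.exp (a * t) * Real.exp (-(a * t)) = 1 := by rw [← Real.exp_add]; simp
    linear_combination (φ 0 + b * ∫ s in (0:ℝ)..t, Real.exp (a * s) * F (x (s - 1))) * h2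
  refine ⟨x, xc, fun t ht => by rw [xX 0 t (by simpa using ht)]; rfl, ?_⟩
  intro τ hτ t ht hle
  rw [xe t ht, xe τ hτ, ← intervalIntegral.integral_add_adjacent_intervals
    ((cont_int hF xc).intervalIntegrable 0 τ) ((cont_int hF xc).intervalIntegrable τ t)]
  ring

lemma growth {a b ℓ μ δ T : ℝ} {H x : ℝ → ℝ} (ha : 0 < a) (hb : 0 < b) (hμ : 0 < μ)
    (hH : Continuous H) (cx : Continuous x) (hs : Sol a b H x (Iic 0))
    (hmono : MonotoneOn x (Iic 0)) (hpos : ∀ t ≤ 0, 0 ≤ x t) (hT : T ≤ 0)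
    (hδ : ∀ t ≤ T, x t ≤ δ) (hℓ : ∀ u, 0 ≤ u → u ≤ δ → ℓ * u ≤ H u)
    (hbℓ : (a + μ) * Real.exp μ ≤ b * ℓ) :
    ∀ σ ≤ T - 1, x σ ≤ x T * Real.exp (μ * (1 - T)) * Real.exp (μ * σ) := by
  intro σ hσ
  have hℓ0 : 0 ≤ ℓ := by
    have : 0 ≤ b * ℓ := le_trans (by positivity) hbℓ
    exact nonneg_of_mul_nonneg_right this hb
  have hx0 : 0 ≤ x σ := hpos σ (by linarith)
  have key := (compare (a := a) (b := b) (T := T) (τ := σ + 1) (H := fun u => ℓ * u)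
    (x := fun t => x σ * Real.exp (μ * (t - (σ + 1)))) (y := x) hb.le (by fun_prop)
    (fun u v h => by simp only; gcongr) (by fun_prop) cx ?_ ?_ ?_).1 T (by linarith) le_rfl
  · have h1 : Real.exp (μ * (T - (σ + 1))) * (Real.exp (μ * (1 - T)) * Real.exp (μ * σ)) = 1 := by
      rw [← Real.exp_add, ← Real.exp_add, Real.exp_eq_one_iff]; ring
    have h2 : 0 < Real.exp (μ * (1 - T)) * Real.exp (μ * σ) := by positivity
    have h3 := mul_le_mul_of_nonneg_right key h2.le
    calc x σ = x σ * Real.exp (μ * (T - (σ + 1))) * (Real.exp (μ * (1 - T)) * Real.exp (μ * σ)) := by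
          rw [mul_assoc, h1, mul_one]
      _ ≤ _ := by rw [mul_assoc (x T)]; exact h3
  · intro t h1 h2
    have e1 : ∀ s, Real.exp (a * s) * (ℓ * (x σ * Real.exp (μ * (s - 1 - (σ + 1))))) =
       Real.exp ((a + μ) * s) * (ℓ * x σ * Real.exp (-μ * (σ + 1)) * Real.exp (-μ)) := by
      intro s
      have : Real.exp (a * s) * Real.exp (μ * (s - 1 - (σ + 1))) = Real.exp ((a + μ) * s) * (Real.exp (-μ * (σ + 1)) * Real.exp (-μ)) := by
        rw [← Real.exp_add, ← Real.exp_add, ← Real.exp_add]; ring_nf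
      linear_combination ℓ * x σ * this
    have e2 : ∀ s, Real.exp (a * s) * (x σ * Real.exp (μ * (s - (σ + 1)))) =
       Real.exp ((a + μ) * s) * (x σ * Real.exp (-μ * (σ + 1))) := by
      intro s
      have : Real.exp (a * s) * Real.exp (μ * (s - (σ + 1))) = Real.exp ((a + μ) * s) * (Real.exp (-μ * (σ + 1))) := by
        rw [← Real.exp_add, ← Real.exp_add]; ring_nf
      linear_combination x σ * this
    rw [e2, e2]
    simp_rw [e1]
    rw [intervalIntegral.integral_mul_const, int_exp _ _ _ (by positivity)]
    have h3 : Real.exp ((a + μ) * (σ + 1)) ≤ Real.exp ((a + μ) * t) := by gcongr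
    have h4 : 1 ≤ b * ℓ * Real.exp (-μ) / (a + μ) := by
      rw [le_div_iff₀ (by positivity), Real.exp_neg, ← div_eq_mul_inv, le_div_iff₀ (by positivity)]
      linarith
    have h5 : 0 ≤ x σ * Real.exp (-μ * (σ + 1)) := by positivity
    have h6 : 0 ≤ (Real.exp ((a + μ) * t) - Real.exp ((a + μ) * (σ + 1))) * (x σ * Real.exp (-μ * (σ + 1))) :=
      mul_nonneg (by linarith) h5
    have h7 := mul_le_mul_of_nonneg_right h4 h6
    have h8 : b * ((Real.exp ((a + μ) * t) - Real.exp ((a + μ) * (σ + 1))) / (a + μ) *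
      (ℓ * x σ * Real.exp (-μ * (σ + 1)) * Real.exp (-μ))) = b * ℓ * Real.exp (-μ) / (a + μ) * ((Real.exp ((a + μ) * t) - Real.exp ((a + μ) * (σ + 1))) * (x σ * Real.exp (-μ * (σ + 1)))) := by
      ring
    rw [h8]
    linarith
  · intro t h1 h2
    rw [hs (σ + 1) (by simp; linarith) t (by simp; linarith) h1]
    gcongr
    apply intervalIntegral.integral_mono_on h1
    · exact Continuous.intervalIntegrable (by fun_prop) _ _
    · exact Continuous.intervalIntegrable (by fun_prop) _ _
    · intro s hs'
      have := hℓ (x (s-1)) (hpos _ (by linarith [hs'.2])) (hδ _ (by linarith [hs'.2]))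
      gcongr
  · intro t h1 h2
    have h3 : x σ ≤ x t := hmono (by simp; linarith) (by simp; linarith) (by linarith)
    have h4 : Real.exp (μ * (t - (σ + 1))) ≤ 1 := by
      rw [Real.exp_le_one_iff]; nlinarith
    nlinarith

lemma uniq_back {a b ℓ L μ δ : ℝ} {H x y : ℝ → ℝ} (ha : 0 < a) (hb : 0 < b) (hμ : 0 < μ) (hδ : 0 < δ)
    (hH : Continuous H) (hm : Monotone H) (cx : Continuous x) (cy : Continuous y)
    (sx : Sol a b H x (Iic 0)) (sy : Sol a b H y (Iic 0))
    (mx : MonotoneOn x (Iic 0)) (my : MonotoneOn y (Iic 0))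
    (px : ∀ t ≤ 0, 0 ≤ x t) (py : ∀ t ≤ 0, 0 ≤ y t)
    (lx : Tendsto x atBot (𝓝 0)) (ly : Tendsto y atBot (𝓝 0)) (h0 : x 0 = y 0)
    (hℓ : ∀ u, 0 ≤ u → u ≤ δ → ℓ * u ≤ H u) (hL0 : 0 ≤ L)
    (hL : ∀ u v, 0 ≤ u → u ≤ δ → 0 ≤ v → v ≤ δ → |H u - H v| ≤ L * |u - v|)
    (hbℓ : (a + μ) * Real.exp μ ≤ b * ℓ)
    (hbL : b * L * (1 - Real.exp (-(a + μ))) < (a + μ) * Real.exp μ) :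
    ∃ T, ∀ t ≤ T, x t = y t := by
  obtain ⟨T1, hT1⟩ := eventually_atBot.1 (lx.eventually (Iio_mem_nhds hδ))
  obtain ⟨T2, hT2⟩ := eventually_atBot.1 (ly.eventually (Iio_mem_nhds hδ))
  set T := min (min T1 T2) 0 with hT
  have hTT1 : T ≤ T1 := (min_le_left _ _).trans (min_le_left _ _)
  have hTT2 : T ≤ T2 := (min_le_left _ _).trans (min_le_right _ _)
  have hT0 : T ≤ 0 := min_le_right _ _
  have dx : ∀ t ≤ T, x t ≤ δ := fun t ht => le_of_lt (hT1 t (ht.trans hTT1))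
  have dy : ∀ t ≤ T, y t ≤ δ := fun t ht => le_of_lt (hT2 t (ht.trans hTT2))
  have gx := growth ha hb hμ hH cx sx mx px hT0 dx hℓ hbℓ
  have gy := growth ha hb hμ hH cy sy my py hT0 dy hℓ hbℓ
  -- zeros
  have zeros : ∀ s ≤ 0, ∃ z ∈ Icc (s - 1) s, x z - y z = 0 := by
    have pos : ∀ p q : ℝ → ℝ, Continuous p → Continuous q → Sol a b H p (Iic 0) → Sol a b H q (Iic 0) →
        p 0 = q 0 → ∀ s ≤ 0, ¬ (∀ z ∈ Icc (s - 1) s, p z < q z) := by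
      intro p q cp cq sp sq h0 s hs hall
      have := (compare (a := a) (b := b) (T := 0) (τ := s) hb.le hH hm cp cq
        (fun t h1 h2 => (sp s hs t h2 h1).le) (fun t h1 h2 => (sq s hs t h2 h1).ge)
        (fun t h1 h2 => (hall t ⟨h1, h2⟩).le)).2 0 hs le_rfl
      rw [h0] at this
      have h3 := hall s ⟨by linarith, le_rfl⟩
      have : 0 < Real.exp (a * s) * (q s - p s) := mul_pos (Real.exp_pos _) (by linarith)
      linarith
    intro s hs
    have c1 : ContinuousOn (fun z => x z - y z) (Icc (s - 1) s) := by fun_prop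
    have n1 := pos x y cx cy sx sy h0 s hs
    have n2 := pos y x cy cx sy sx h0.symm s hs
    push Not at n1 n2
    obtain ⟨z1, hz1, h1⟩ := n1
    obtain ⟨z2, hz2, h2⟩ := n2
    have := (isPreconnected_Icc (a := s - 1) (b := s)).intermediate_value hz2 hz1 c1
    exact this ⟨by linarith, by linarith⟩
  set θ := b * L * (1 - Real.exp (-(a + μ))) / ((a + μ) * Real.exp μ) with hθ
  have hE : Real.exp (-(a + μ)) < 1 := by rw [Real.exp_lt_one_iff]; linarith
  have hθ0 : 0 ≤ θ := div_nonneg (mul_nonneg (by positivity) (by linarith)) (by positivity)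
  have hθ1 : θ < 1 := by rw [hθ, div_lt_one (by positivity)]; exact hbL
  have contr : ∀ A, 0 ≤ A → (∀ σ ≤ T - 1, |x σ - y σ| ≤ A * Real.exp (μ * σ)) →
      (∀ σ ≤ T - 1, |x σ - y σ| ≤ (θ * A) * Real.exp (μ * σ)) := by
    intro A hA h s hs
    obtain ⟨z, ⟨hz1, hz2⟩, hz⟩ := zeros s (by linarith)
    have ex := sx z (by simp; linarith) s (by simp; linarith) hz2
    have ey := sy z (by simp; linarith) s (by simp; linarith) hz2
    have e3 : Real.exp (a * s) * (x s - y s) = b * ∫ r in z..s, Real.exp (a * r) * (H (x (r - 1)) - H (y (r - 1))) := by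
      have : ∫ r in z..s, Real.exp (a * r) * (H (x (r - 1)) - H (y (r - 1))) =
        (∫ r in z..s, Real.exp (a * r) * H (x (r - 1))) - ∫ r in z..s, Real.exp (a * r) * H (y (r - 1)) := by
        rw [← intervalIntegral.integral_sub ((cont_int hH cx).intervalIntegrable _ _)
          ((cont_int hH cy).intervalIntegrable _ _)]
        congr 1; ext r; ring
      rw [this]
      linear_combination ex - ey + Real.exp (a * z) * hz
    have e4 : |∫ r in z..s, Real.exp (a * r) * (H (x (r - 1)) - H (y (r - 1)))| ≤
        ∫ r in z..s, Real.exp ((a + μ) * r) * (L * A * Real.exp (-μ)) := by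
      rw [← Real.norm_eq_abs]
      apply intervalIntegral.norm_integral_le_of_norm_le hz2 _ (Continuous.intervalIntegrable (by fun_prop) _ _)
      filter_upwards with r hr
      rw [Real.norm_eq_abs, abs_mul, abs_of_pos (Real.exp_pos _)]
      have h1 := hL (x (r-1)) (y (r-1)) (px _ (by linarith [hr.2])) (dx _ (by linarith [hr.2]))
        (py _ (by linarith [hr.2])) (dy _ (by linarith [hr.2]))
      have h2 := h (r - 1) (by linarith [hr.2])
      have h3 : Real.exp ((a + μ) * r) * (L * A * Real.exp (-μ)) = Real.exp (a * r) * (L * (A * Real.exp (μ * (r - 1)))) := by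
        have : Real.exp ((a + μ) * r) * Real.exp (-μ) = Real.exp (a * r) * Real.exp (μ * (r - 1)) := by
          rw [← Real.exp_add, ← Real.exp_add]; ring_nf
        linear_combination L * A * this
      rw [h3]
      gcongr
      exact h1.trans (by gcongr)
    rw [intervalIntegral.integral_mul_const, int_exp _ _ _ (by positivity)] at e4
    have e5 : Real.exp ((a + μ) * s) * Real.exp (-(a + μ)) ≤ Real.exp ((a + μ) * z) := by
      rw [← Real.exp_add]; gcongr; nlinarith
    have e6 : Real.exp (a * s) * |x s - y s| ≤ b * ((Real.exp ((a + μ) * s) * (1 - Real.exp (-(a + μ)))) / (a + μ) * (L * A * Real.exp (-μ))) := by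
      calc Real.exp (a * s) * |x s - y s| = |Real.exp (a * s) * (x s - y s)| := by
            rw [abs_mul, abs_of_pos (Real.exp_pos _)]
        _ = b * |∫ r in z..s, Real.exp (a * r) * (H (x (r - 1)) - H (y (r - 1)))| := by
            rw [e3, abs_mul, abs_of_pos hb]
        _ ≤ _ := by
            refine mul_le_mul_of_nonneg_left (e4.trans ?_) hb.le
            gcongr
            linarith
    have e7 : b * ((Real.exp ((a + μ) * s) * (1 - Real.exp (-(a + μ)))) / (a + μ) * (L * A * Real.exp (-μ)))
        = Real.exp (a * s) * (θ * A * Real.exp (μ * s)) := by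
      rw [hθ, add_mul a μ s, Real.exp_add, Real.exp_neg μ]
      field_simp
    rw [e7] at e6
    exact le_of_mul_le_mul_left e6 (Real.exp_pos _)
  set A0 := x T * Real.exp (μ * (1 - T)) + y T * Real.exp (μ * (1 - T)) with hA0
  have hA0' : 0 ≤ A0 := by
    have := px T hT0
    have := py T hT0
    positivity
  have iter : ∀ k : ℕ, ∀ σ ≤ T - 1, |x σ - y σ| ≤ (θ ^ k * A0) * Real.exp (μ * σ) := by
    intro k
    induction k with
    | zero =>
      intro σ hσ
      have h1 := gx σ hσ
      have h2 := gy σ hσ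
      have h3 := px σ (by linarith)
      have h4 := py σ (by linarith)
      rw [pow_zero, one_mul, hA0, add_mul, abs_le]
      constructor <;> linarith
    | succ k ih =>
      intro σ hσ
      have := contr _ (by positivity) ih σ hσ
      rwa [← mul_assoc, ← pow_succ'] at this
  refine ⟨T - 1, fun t ht => ?_⟩
  have lim : Tendsto (fun k : ℕ => (θ ^ k * A0) * Real.exp (μ * t)) atTop (𝓝 (0 * A0 * Real.exp (μ * t))) :=
    ((tendsto_pow_atTop_nhds_zero_of_lt_one hθ0 hθ1).mul_const _).mul_const _
  have := ge_of_tendsto' lim (fun k => iter k t ht)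
  rw [zero_mul, zero_mul] at this
  have := abs_nonpos_iff.1 this
  linarith

/-- forward uniqueness -/
lemma uniq_fwd {a b : ℝ} {F x y : ℝ → ℝ} (sx : Sol a b F x univ) (sy : Sol a b F y univ) {T : ℝ}
    (h : ∀ t ≤ T, x t = y t) : x = y := by
  funext t
  refine step_ind (P := fun t => x t = y t) (τ := T) (T := t) h ?_ t le_rfl
  intro s hs ih t' h1 h2 h3
  have ex := sx s trivial t' trivial h1
  have ey := sy s trivial t' trivial h1
  have : ∫ r in s..t', Real.exp (a * r) * F (x (r - 1)) = ∫ r in s..t', Real.exp (a * r) * F (y (r - 1)) := by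
    apply intervalIntegral.integral_congr
    intro r hr
    rw [uIcc_of_le h1] at hr
    simp only
    rw [ih (r - 1) (by linarith [hr.2]) (by linarith [hr.2])]
  rw [ih s le_rfl (by linarith), this, ← ey] at ex
  exact mul_left_cancel₀ (Real.exp_pos _).ne' ex

lemma exists_mu {a b p : ℝ} (ha : 0 < a) (hb : 0 < b) (hp : a < b * p) :
    ∃ μ ℓ L : ℝ, 0 < μ ∧ ℓ < p ∧ p < L ∧ (a + μ) * Real.exp μ ≤ b * ℓ ∧
      b * L * (1 - Real.exp (-(a + μ))) < (a + μ) * Real.exp μ := by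
  have cG : Continuous (fun μ : ℝ => (a + μ) * Real.exp μ) := by fun_prop
  have : ∃ lam ∈ Icc (0:ℝ) (b * p), (fun μ : ℝ => (a + μ) * Real.exp μ) lam = b * p := by
    apply intermediate_value_Icc (by linarith) cG.continuousOn
    constructor
    · simp; linarith
    · have h1 : 1 ≤ Real.exp (b * p) := Real.one_le_exp (by linarith)
      nlinarith
  obtain ⟨lam, ⟨hl0, _⟩, hl⟩ := this
  simp only at hl
  have hl1 : 0 < lam := by
    rcases hl0.lt_or_eq with h | h
    · exact h
    · rw [← h] at hl; simp at hl; linarith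
  have h2 : b * p * (1 - Real.exp (-(a + lam))) < (a + lam) * Real.exp lam := by
    rw [hl]
    have := Real.exp_pos (-(a + lam))
    nlinarith
  have c1 : Continuous (fun μ : ℝ => b * p * (1 - Real.exp (-(a + μ)))) := by fun_prop
  have ev := (c1.continuousAt (x := lam)).eventually_lt cG.continuousAt h2
  have ev2 : ∀ᶠ μ in 𝓝[<] lam, b * p * (1 - Real.exp (-(a + μ))) < (a + μ) * Real.exp μ ∧ 0 < μ ∧ μ < lam := by
    filter_upwards [nhdsWithin_le_nhds ev, nhdsWithin_le_nhds (Ioi_mem_nhds hl1), self_mem_nhdsWithin] with μ h1 h2 h3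
    exact ⟨h1, h2, h3⟩
  obtain ⟨μ, h3, h4, h5⟩ := ev2.exists
  have c2 : Continuous (fun L : ℝ => b * L * (1 - Real.exp (-(a + μ)))) := by fun_prop
  have ev3 : ∀ᶠ L in 𝓝[>] p, b * L * (1 - Real.exp (-(a + μ))) < (a + μ) * Real.exp μ ∧ p < L := by
    filter_upwards [nhdsWithin_le_nhds ((c2.continuousAt (x := p)).eventually (Iio_mem_nhds h3)), self_mem_nhdsWithin] with L h1 h2
    exact ⟨h1, h2⟩
  obtain ⟨L, h6, h7⟩ := ev3.exists
  refine ⟨μ, (a + μ) * Real.exp μ / b, L, h4, ?_, h7, ?_, h6⟩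
  · rw [div_lt_iff₀ hb, mul_comm p b, ← hl]
    gcongr
  · rw [mul_div_cancel₀ _ hb.ne']

lemma exists_subseq {K' Λ : ℝ} {u : ℕ → ℝ → ℝ} (hΛ : 0 ≤ Λ) (hb : ∀ k t, u k t ∈ Icc 0 K')
    (hlip : ∀ k s t, |u k s - u k t| ≤ Λ * |s - t|) :
    ∃ φ : ℕ → ℕ, StrictMono φ ∧ ∃ l : ℝ → ℝ, ∀ t, Tendsto (fun k => u (φ k) t) atTop (𝓝 (l t)) := by
  have hc : IsCompact (Set.pi univ (fun _ : ℚ => Icc (0:ℝ) K')) := isCompact_univ_pi fun _ => isCompact_Icc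
  obtain ⟨l, -, φ, hφ, hl⟩ := hc.tendsto_subseq (x := fun k => fun q : ℚ => u k q)
    (fun k q _ => hb k q)
  rw [tendsto_pi_nhds] at hl
  refine ⟨φ, hφ, ?_⟩
  have : ∀ t, ∃ l, Tendsto (fun k => u (φ k) t) atTop (𝓝 l) := by
    intro t
    apply cauchySeq_tendsto_of_complete
    rw [Metric.cauchySeq_iff']
    intro ε hε
    obtain ⟨q, hq1, hq2⟩ := exists_rat_btwn (show t < t + ε / (4 * (Λ + 1)) by
      have : 0 < ε / (4 * (Λ + 1)) := by positivity
      linarith)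
    have hq : Λ * |t - q| ≤ ε / 4 := by
      have h1 : |t - q| ≤ ε / (4 * (Λ + 1)) := by rw [abs_le]; constructor <;> linarith
      calc Λ * |t - q| ≤ (Λ + 1) * (ε / (4 * (Λ + 1))) := by gcongr; linarith
        _ = ε / 4 := by field_simp
    obtain ⟨N, hN⟩ := Metric.cauchySeq_iff'.1 (hl q).cauchySeq (ε / 4) (by positivity)
    refine ⟨N, fun n hn => ?_⟩
    have h1 := hN n hn
    have h2 := hlip (φ n) t q
    have h3 := hlip (φ N) t q
    rw [Real.dist_eq] at h1 ⊢
    simp only [Function.comp] at h1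
    rw [abs_lt] at h1 ⊢
    rw [abs_le] at h2 h3
    constructor <;> linarith [h1.1, h1.2, h2.1, h2.2, h3.1, h3.2]
  choose l' hl' using this
  exact ⟨l', hl'⟩

lemma exists_approx {a b K M L₀ : ℝ} {H : ℝ → ℝ} (ha : 0 < a) (hb : 0 < b) (hm : Monotone H)
    (hc : Continuous H)
    (hL₀ : 0 ≤ L₀) (hL : ∀ u v, |H u - H v| ≤ L₀ * |u - v|) (H0 : H 0 = 0) (hK : 0 < K) (hKM : K ≤ M)
    (hM : b * H M ≤ a * M) (hpos : ∀ u, 0 < u → u ≤ K → a * u < b * H u) (k : ℕ) :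
    ∃ u : ℝ → ℝ, Continuous u ∧ Sol a b H u (Ici (-k)) ∧ Monotone u ∧ u 0 = K ∧ 
      (∀ t, u t ∈ Icc 0 M) ∧ ∀ s t, |u s - u t| ≤ b * H M * |s - t| := by
  choose v vc v0 vs using fun ε : ℝ => exists_ext (a := a) (b := b) hc (continuous_const (y := ε))
  have hsub : ∀ ε, 0 ≤ ε → ε ≤ K → a * ε ≤ b * H ε := by
    intro ε h1 h2
    rcases h1.lt_or_eq with h | h
    · exact (hpos ε h h2).le
    · rw [← h, H0]; simp
  have lower : ∀ ε, 0 ≤ ε → ε ≤ K → ∀ t, ε ≤ v ε t := by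
    intro ε h1 h2 t
    rcases le_total t 0 with ht | ht
    · rw [v0 ε t ht]
    refine (compare (a := a) (b := b) (T := t) (τ := 0) (x := fun _ => ε) hb.le hc hm continuous_const (vc ε)
      (fun r hr _ => Sol.const_sub ha (hsub ε h1 h2) hr)
      (fun r hr _ => (vs ε 0 (by simp) r hr hr).ge) (fun r _ hr => (v0 ε r hr).ge)).1 t (by linarith) le_rfl
  have upper : ∀ C, b * H C ≤ a * C → ∀ ε ≤ C, ∀ t, v ε t ≤ C := by
    intro C hC ε h1 t
    rcases le_total t 0 with ht | ht
    · rwa [v0 ε t ht]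
    refine (compare (a := a) (b := b) (T := t) (τ := 0) (y := fun _ => C) hb.le hc hm (vc ε) continuous_const
      (fun r hr _ => (vs ε 0 (by simp) r hr hr).le)
      (fun r hr _ => Sol.const_super ha hC hr)
      (fun r _ hr => by rw [v0 ε r hr]; exact h1)).1 t (by linarith) le_rfl
  have mono : ∀ ε, 0 ≤ ε → ε ≤ K → Monotone (v ε) := by
    intro ε h1 h2 t1 t2 h12
    rcases le_total t1 0 with ht | ht
    · rw [v0 ε t1 ht]; exact lower ε h1 h2 t2
    have sh := (vs ε).shift (t2 - t1)
    have := (compare (a := a) (b := b) (T := t1) (τ := 0) (x := v ε) (y := fun t => v ε (t + (t2 - t1))) hb.le hc hm (vc ε)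
      ((vc ε).comp (by fun_prop)) (fun r hr _ => (vs ε 0 (by simp) r hr hr).le)
      (fun r hr _ => (sh 0 (by simp; linarith) r (by simp; linarith) hr).ge)
      (fun r _ hr => by rw [v0 ε r hr]; exact lower ε h1 h2 _)).1 t1 (by linarith) le_rfl
    simpa using this
  have lipε : ∀ ε ε' : ℝ, ∀ j : ℕ, ∀ t ≤ (j:ℝ), |v ε t - v ε' t| ≤ (1 + b * L₀) ^ j * |ε - ε'| := by
    intro ε ε' j
    induction j with
    | zero =>
      intro t ht
      have ht' : t ≤ 0 := by simpa using ht
      rw [v0 _ t ht', v0 _ t ht']; simp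
    | succ j ih =>
      intro t ht
      push_cast at ht
      have mono1 : (1 + b * L₀) ^ j * |ε - ε'| ≤ (1 + b * L₀) ^ (j+1) * |ε - ε'| := by
        gcongr
        · have : 0 ≤ b * L₀ := by positivity
          linarith
        · omega
      by_cases hj : t ≤ j
      · exact (ih t hj).trans mono1
      have hj' : (j:ℝ) ≤ t := le_of_not_ge hj
      have hj0 : (0:ℝ) ≤ j := by positivity
      set D := (1 + b * L₀) ^ j * |ε - ε'| with hD
      have hD0 : 0 ≤ D := by positivity
      have ex := vs ε j hj0 t (hj0.trans hj') hj'
      have ey := vs ε' j hj0 t (hj0.trans hj') hj'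
      have e3 : Real.exp (a * t) * (v ε t - v ε' t) = Real.exp (a * j) * (v ε j - v ε' j) +
          b * ∫ r in (j:ℝ)..t, Real.exp (a * r) * (H (v ε (r - 1)) - H (v ε' (r - 1))) := by
        have : ∫ r in (j:ℝ)..t, Real.exp (a * r) * (H (v ε (r - 1)) - H (v ε' (r - 1))) =
          (∫ r in (j:ℝ)..t, Real.exp (a * r) * H (v ε (r - 1))) - ∫ r in (j:ℝ)..t, Real.exp (a * r) * H (v ε' (r - 1)) := by
          rw [← intervalIntegral.integral_sub ((cont_int hc (vc ε)).intervalIntegrable _ _)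
            ((cont_int hc (vc ε')).intervalIntegrable _ _)]
          congr 1; ext r; ring
        rw [this]
        linear_combination ex - ey
      have e4 : |∫ r in (j:ℝ)..t, Real.exp (a * r) * (H (v ε (r - 1)) - H (v ε' (r - 1)))| ≤
          Real.exp (a * t) * (L₀ * D) * |t - j| := by
        rw [← Real.norm_eq_abs]
        apply intervalIntegral.norm_integral_le_of_norm_le_const
        intro r hr
        rw [uIoc_of_le hj'] at hr
        rw [Real.norm_eq_abs, abs_mul, abs_of_pos (Real.exp_pos _)]
        have h1 := hL (v ε (r-1)) (v ε' (r-1))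
        have h2 := ih (r - 1) (by linarith [hr.2])
        have h3 : Real.exp (a * r) ≤ Real.exp (a * t) := by gcongr; exact hr.2
        gcongr
        exact h1.trans (by gcongr)
      rw [abs_of_nonneg (by linarith : 0 ≤ t - j)] at e4
      have e5 : Real.exp (a * t) * |v ε t - v ε' t| ≤ Real.exp (a * t) * D + b * (Real.exp (a * t) * (L₀ * D)) := by
        calc Real.exp (a * t) * |v ε t - v ε' t| = |Real.exp (a * t) * (v ε t - v ε' t)| := by
              rw [abs_mul, abs_of_pos (Real.exp_pos _)]
          _ ≤ Real.exp (a * j) * |v ε j - v ε' j| + b * |∫ r in (j:ℝ)..t, Real.exp (a * r) * (H (v ε (r - 1)) - H (v ε' (r - 1)))| := by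
              rw [e3]
              refine (abs_add_le _ _).trans ?_
              rw [abs_mul, abs_mul, abs_of_pos (Real.exp_pos _), abs_of_pos hb]
          _ ≤ _ := by
              have h1 := ih j le_rfl
              have h2 : Real.exp (a * t) * (L₀ * D) * (t - j) ≤ Real.exp (a * t) * (L₀ * D) * 1 := by
                gcongr; linarith
              gcongr
              linarith
      have e6 : Real.exp (a * t) * |v ε t - v ε' t| ≤ Real.exp (a * t) * ((1 + b * L₀) ^ (j+1) * |ε - ε'|) := by
        refine e5.trans (le_of_eq ?_)
        rw [hD, pow_succ]; ring
      exact le_of_mul_le_mul_left e6 (Real.exp_pos _)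
  have cε : Continuous (fun ε => v ε k) := by
    have : LipschitzWith (Real.toNNReal ((1 + b * L₀) ^ k)) (fun ε => v ε k) :=
      LipschitzWith.of_dist_le' (fun x y => by rw [Real.dist_eq, Real.dist_eq]; exact lipε x y k k le_rfl)
    exact this.continuous
  obtain ⟨ε, ⟨hε0, hεK⟩, hε⟩ := intermediate_value_Icc hK.le cε.continuousOn
    (show K ∈ Icc (v 0 k) (v K k) from
      ⟨(upper 0 (by simp [H0]) 0 le_rfl k).trans hK.le, lower K hK.le le_rfl k⟩)
  simp only at hε
  have HM0 : 0 ≤ H M := by rw [← H0]; exact hm (hK.le.trans hKM)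
  have vM := upper M hM ε (hεK.trans hKM)
  have lip1 : ∀ s t, 0 ≤ s → s ≤ t → v ε t - v ε s ≤ b * H M * (t - s) := by
    intro s t hs hst
    have e1 := vs ε s hs t (hs.trans hst) hst
    have e2 : ∫ r in s..t, Real.exp (a * r) * H (v ε (r - 1)) ≤ ∫ r in s..t, Real.exp (a * t) * H M := by
      apply intervalIntegral.integral_mono_on hst ((cont_int hc (vc ε)).intervalIntegrable _ _) (by simp)
      intro r hr
      have h1 := hm (vM (r - 1))
      have h3 : Real.exp (a * r) ≤ Real.exp (a * t) := by gcongr; exact hr.2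
      calc Real.exp (a * r) * H (v ε (r - 1)) ≤ Real.exp (a * r) * H M := by gcongr
        _ ≤ _ := by gcongr
    rw [intervalIntegral.integral_const, smul_eq_mul] at e2
    have e3 : Real.exp (a * s) * v ε s ≤ Real.exp (a * t) * v ε s := by
      have := hε0.trans (lower ε hε0 hεK s)
      gcongr
    have e4 : Real.exp (a * t) * v ε t ≤ Real.exp (a * t) * (v ε s + b * H M * (t - s)) := by
      have := mul_le_mul_of_nonneg_left e2 hb.le
      nlinarith
    have := le_of_mul_le_mul_left e4 (Real.exp_pos _)
    linarith
  have lip2 : ∀ s t, s ≤ t → v ε t - v ε s ≤ b * H M * (t - s) := by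
    intro s t hst
    have hbM : 0 ≤ b * H M := by positivity
    rcases le_total 0 s with hs | hs
    · exact lip1 s t hs hst
    rcases le_total 0 t with ht | ht
    · have h1 := lip1 0 t le_rfl ht
      rw [v0 ε 0 le_rfl] at h1
      rw [v0 ε s hs]
      nlinarith
    · rw [v0 ε s hs, v0 ε t ht, sub_self]
      exact mul_nonneg hbM (by linarith)
  refine ⟨fun t => v ε (t + k), (vc ε).comp (by fun_prop), ?_, ?_, ?_, ?_, ?_⟩
  · simpa using (vs ε).shift k
  · intro s t hst
    exact mono ε hε0 hεK (by linarith)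
  · simpa using hε
  · exact fun t => ⟨hε0.trans (lower ε hε0 hεK _), vM _⟩
  · have : ∀ s t, s ≤ t → |v ε s - v ε t| ≤ b * H M * |s - t| := by
      intro s t hst
      rw [abs_of_nonpos (by linarith [mono ε hε0 hεK hst]), abs_of_nonpos (by linarith)]
      have := lip2 s t hst
      linarith
    intro s t
    rcases le_total s t with h | h
    · simpa using this (s + k) (t + k) (by linarith)
    · rw [abs_sub_comm, abs_sub_comm s]
      simpa using this (t + k) (s + k) (by linarith)

lemma mono_ineq {a b : ℝ} {H l : ℝ → ℝ} (ha : 0 < a) (hb : 0 < b) (hm : Monotone H)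
    (hc : Continuous H) (lc : Continuous l) (ls : Sol a b H l univ) (lm : Monotone l) :
    ∀ t, Real.exp (-a) * l (t - 1) + b * H (l (t - 2)) * ((1 - Real.exp (-a)) / a) ≤ l t := by
  intro t
  have e1 := ls (t - 1) trivial t trivial (by linarith)
  have e2 : ∫ s in (t-1)..t, Real.exp (a * s) * H (l (t - 2)) ≤ ∫ s in (t-1)..t, Real.exp (a * s) * H (l (s - 1)) := by
    apply intervalIntegral.integral_mono_on (by linarith) (Continuous.intervalIntegrable (by fun_prop) _ _) ((cont_int hc lc).intervalIntegrable _ _)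
    intro s hs
    have := hm (lm (show t - 2 ≤ s - 1 by linarith [hs.1]))
    gcongr
  rw [intervalIntegral.integral_mul_const, int_exp _ _ _ ha.ne'] at e2
  have e3 : Real.exp (a * (t - 1)) = Real.exp (a * t) * Real.exp (-a) := by
    rw [← Real.exp_add]; ring_nf
  rw [e3] at e1 e2
  have e4 := mul_le_mul_of_nonneg_left e2 hb.le
  refine le_of_mul_le_mul_left ?_ (Real.exp_pos (a * t))
  rw [e1]
  refine le_trans (le_of_eq ?_) (add_le_add_right e4 _)
  ring

lemma exists_het {a b K M L₀ : ℝ} {H : ℝ → ℝ} (ha : 0 < a) (hb : 0 < b) (hm : Monotone H)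
    (hc : Continuous H)
    (hL₀ : 0 ≤ L₀) (hL : ∀ u v, |H u - H v| ≤ L₀ * |u - v|) (H0 : H 0 = 0) (hK : 0 < K) (hKM : K ≤ M)
    (hM : b * H M ≤ a * M) (hpos : ∀ u, 0 < u → u ≤ K → a * u < b * H u) :
    ∃ u : ℝ → ℝ, Continuous u ∧ Sol a b H u univ ∧ StrictMono u ∧ u 0 = K ∧ 
      Tendsto u atBot (𝓝 0) ∧ (∀ t, u t ≤ M) := by
  choose u uc us um u0 ub ul using exists_approx ha hb hm hc hL₀ hL H0 hK hKM hM hpos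
  have HM0 : 0 ≤ H M := by rw [← H0]; exact hm (hK.le.trans hKM)
  obtain ⟨φ, hφ, l, hl⟩ := exists_subseq (by positivity) ub ul
  have lb : ∀ t, l t ∈ Icc 0 M := fun t => isClosed_Icc.mem_of_tendsto (hl t) (Eventually.of_forall fun k => ub _ t)
  have l0 : l 0 = K := by
    refine tendsto_nhds_unique (hl 0) ?_
    simp only [u0]; exact tendsto_const_nhds
  have lm : Monotone l := fun s t hst => le_of_tendsto_of_tendsto' (hl s) (hl t) (fun k => um _ hst)
  have lc : Continuous l := by
    have : LipschitzWith (Real.toNNReal (b * H M)) l := LipschitzWith.of_dist_le' (fun x y => by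
      rw [Real.dist_eq, Real.dist_eq]
      exact le_of_tendsto' ((hl x).sub (hl y)).abs (fun k => ul _ x y))
    exact this.continuous
  have ls : Sol a b H l univ := by
    intro τ _ t _ hle
    have h1 : Tendsto (fun k => ∫ s in τ..t, Real.exp (a * s) * H (u (φ k) (s - 1))) atTop
        (𝓝 (∫ s in τ..t, Real.exp (a * s) * H (l (s - 1)))) := by
      apply intervalIntegral.tendsto_integral_filter_of_dominated_convergence (fun s => Real.exp (a * s) * H M)
      · exact Eventually.of_forall fun k => (cont_int hc (uc _)).aestronglyMeasurable
      · refine Eventually.of_forall fun k => Eventually.of_forall fun s _ => ?_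
        have h1 : 0 ≤ H (u (φ k) (s - 1)) := by rw [← H0]; exact hm (ub _ _).1
        have h2 := hm (ub (φ k) (s - 1)).2
        rw [Real.norm_eq_abs, abs_of_nonneg (by positivity)]
        gcongr
      · exact Continuous.intervalIntegrable (by fun_prop) _ _
      · refine Eventually.of_forall fun s _ => ?_
        exact ((hc.tendsto _).comp (hl (s - 1))).const_mul _
    have h2 : Tendsto (fun k => Real.exp (a * τ) * u (φ k) τ + b * ∫ s in τ..t, Real.exp (a * s) * H (u (φ k) (s - 1))) atTop
        (𝓝 (Real.exp (a * τ) * l τ + b * ∫ s in τ..t, Real.exp (a * s) * H (l (s - 1)))) :=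
      ((hl τ).const_mul _).add (h1.const_mul _)
    have h3 : Tendsto (fun k => Real.exp (a * t) * u (φ k) t) atTop (𝓝 (Real.exp (a * t) * l t)) := (hl t).const_mul _
    refine tendsto_nhds_unique h3 (h2.congr' ?_)
    obtain ⟨N, hN⟩ := exists_nat_ge (-τ)
    filter_upwards [eventually_ge_atTop N] with k hk
    have : (N:ℝ) ≤ φ k := by exact_mod_cast hk.trans (hφ.id_le k)
    exact (us (φ k) τ (by simp; linarith) t (by simp; linarith) hle).symm
  -- limit at minus infinity
  have ltend : Tendsto l atBot (𝓝 0) := by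
    have hbdd : BddBelow (range l) := ⟨0, by rintro _ ⟨t, rfl⟩; exact (lb t).1⟩
    have h1 := tendsto_atBot_ciInf lm hbdd
    set e := ⨅ t, l t with he
    have e0 : 0 ≤ e := le_ciInf fun t => (lb t).1
    have eK : e ≤ K := by rw [← l0]; exact ciInf_le hbdd 0
    have hineq := mono_ineq ha hb hm hc lc ls lm
    have sh : ∀ r : ℝ, Tendsto (fun t => l (t - r)) atBot (𝓝 e) := fun r =>
      h1.comp (tendsto_atBot_add_const_right _ _ tendsto_id)
    have h3 : Real.exp (-a) * e + b * H e * ((1 - Real.exp (-a)) / a) ≤ e := by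
      refine le_of_tendsto_of_tendsto' ?_ h1 hineq
      exact ((sh 1).const_mul _).add ((((hc.tendsto _).comp (sh 2)).const_mul _).mul_const _)
    rcases e0.lt_or_eq with h | h
    · exfalso
      have h4 := hpos e h eK
      have h5 : Real.exp (-a) < 1 := by rw [Real.exp_lt_one_iff]; linarith
      have h6 : a * e * ((1 - Real.exp (-a)) / a) < b * H e * ((1 - Real.exp (-a)) / a) := by
        have : 0 < (1 - Real.exp (-a)) / a := div_pos (by linarith) ha
        gcongr
      have h7 : a * e * ((1 - Real.exp (-a)) / a) = e * (1 - Real.exp (-a)) := by field_simp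
      linarith
    · rwa [← h] at h1
  have lstrict : StrictMono l := by
    intro t1 t2 h12
    refine lt_of_le_of_ne (lm h12.le) fun heq => ?_
    set s := t2 - t1 with hs
    have hs0 : 0 < s := by linarith
    have shs : ∀ T, Sol a b H (fun t => l (t + s)) (Ici (T - s)) := fun T => (ls.mono (subset_univ (Ici T))).shift s
    have per : ∀ τ ≤ t1, l (τ + s) = l τ := by
      intro τ hτ
      have := (compare (a := a) (b := b) (T := t1) (τ := τ) (x := l) (y := fun t => l (t + s)) hb.le hc hm lc
        (lc.comp (by fun_prop)) (fun r hr _ => (ls τ trivial r trivial hr).le)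
        (fun r hr _ => (shs (τ + s) τ (by simp) r (by simp; linarith) hr).ge)
        (fun r _ _ => lm (by linarith))).2 t1 hτ le_rfl
      rw [show t1 + s = t2 by rw [hs]; ring, heq, sub_self, mul_zero] at this
      have h3 : l (τ + s) - l τ ≤ 0 := by
        by_contra hcon
        push Not at hcon
        have := mul_pos (Real.exp_pos (a * τ)) hcon
        linarith
      have h4 : l τ ≤ l (τ + s) := lm (by linarith)
      linarith
    have perk : ∀ k : ℕ, l (t1 - k * s) = l t1 := by
      intro k
      induction k with
      | zero => simp
      | succ k ih =>
        have : 0 ≤ (k:ℝ) * s := by positivity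
        rw [← ih, ← per (t1 - (k+1:ℕ) * s) (by push_cast; linarith)]
        congr 1; push_cast; ring
    have hlim : Tendsto (fun k : ℕ => l (t1 - k * s)) atTop (𝓝 0) := by
      apply ltend.comp
      have h1 : Tendsto (fun k : ℕ => (k:ℝ) * s) atTop atTop := tendsto_natCast_atTop_atTop.atTop_mul_const hs0
      simp only [sub_eq_add_neg]
      exact tendsto_atBot_add_const_left _ _ (tendsto_neg_atTop_atBot.comp h1)
    simp only [perk] at hlim
    have lt1 : l t1 = 0 := tendsto_nhds_unique tendsto_const_nhds hlim
    have hz : l = fun _ => 0 := by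
      apply uniq_fwd ls (y := fun _ => 0) (a := a) (b := b) (T := t1)
      · intro τ _ t _ _; simp [H0]
      · intro t ht
        have := lm ht
        have := (lb t).1
        linarith
    rw [hz] at l0
    linarith
  exact ⟨l, lc, ls, lstrict, l0, ltend, fun t => (lb t).2⟩

lemma Sol.affine {a b σ ξ : ℝ} {G H u y : ℝ → ℝ} {J : Set ℝ} (ha : 0 < a) (hσ : σ ≠ 0)
    (hJ : J.OrdConnected) (hH : Continuous H) (cu : Continuous u)
    (hξ : a * ξ = b * G ξ) (hy : ∀ t ∈ J, y t = ξ + σ * u t)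
    (hG : ∀ s ∈ J, G (y (s - 1)) = G ξ + σ * H (u (s - 1))) :
    Sol a b H u J ↔ Sol a b G y J := by
  have key : ∀ τ ∈ J, ∀ t ∈ J, τ ≤ t →
      b * ∫ s in τ..t, Real.exp (a * s) * G (y (s - 1)) =
      (Real.exp (a * t) - Real.exp (a * τ)) * ξ + σ * (b * ∫ s in τ..t, Real.exp (a * s) * H (u (s - 1))) := by
    intro τ hτ t ht hle
    have h1 : ∫ s in τ..t, Real.exp (a * s) * G (y (s - 1)) =
        ∫ s in τ..t, (Real.exp (a * s) * G ξ + σ * (Real.exp (a * s) * H (u (s - 1)))) := by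
      apply intervalIntegral.integral_congr
      intro s hs
      rw [uIcc_of_le hle] at hs
      simp only
      rw [hG s (hJ.out hτ ht hs)]; ring
    rw [h1, intervalIntegral.integral_add (Continuous.intervalIntegrable (by fun_prop) _ _)
      (Continuous.intervalIntegrable (by fun_prop) _ _), intervalIntegral.integral_mul_const,
      intervalIntegral.integral_const_mul, int_exp _ _ _ ha.ne']
    have h2 : ξ = b * G ξ / a := by field_simp; linarith
    have h3 : (Real.exp (a * t) - Real.exp (a * τ)) * ξ = (Real.exp (a * t) - Real.exp (a * τ)) * (b * G ξ / a) := by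
      rw [← h2]
    rw [h3]; ring
  constructor
  · intro h τ hτ t ht hle
    rw [key τ hτ t ht hle, hy t ht, hy τ hτ]
    linear_combination σ * h τ hτ t ht hle
  · intro h τ hτ t ht hle
    have := h τ hτ t ht hle
    rw [key τ hτ t ht hle, hy t ht, hy τ hτ] at this
    apply mul_left_cancel₀ hσ
    linear_combination this

lemma Sol.congr {a b : ℝ} {G G' x y : ℝ → ℝ} {J : Set ℝ} (hJ : J.OrdConnected)
    (h : Sol a b G x J) (hxy : ∀ t ∈ J, x t = y t)
    (hG : ∀ s ∈ J, G (x (s - 1)) = G' (y (s - 1))) : Sol a b G' y J := by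
  intro τ hτ t ht hle
  rw [← hxy t ht, ← hxy τ hτ, h τ hτ t ht hle]
  congr 2
  apply intervalIntegral.integral_congr
  intro s hs
  rw [uIcc_of_le hle] at hs
  simp only
  rw [hG s (hJ.out hτ ht hs)]

lemma Sol.concat {a b : ℝ} {G x : ℝ → ℝ} (hG : Continuous G) (cx : Continuous x)
    (h1 : Sol a b G x (Iic 0)) (h2 : Sol a b G x (Ici 0)) : Sol a b G x univ := by
  intro τ _ t _ hle
  rcases le_total t 0 with ht | ht
  · exact h1 τ (hle.trans ht) t ht hle
  rcases le_total 0 τ with hτ | hτ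
  · exact h2 τ hτ t ht hle
  have e1 := h1 τ hτ 0 (by simp) hτ
  have e2 := h2 0 (by simp) t ht ht
  rw [e2, e1, ← intervalIntegral.integral_add_adjacent_intervals
    ((cont_int hG cx).intervalIntegrable τ 0) ((cont_int hG cx).intervalIntegrable 0 t)]
  ring

lemma isSolR_iff {a b : ℝ} {f G y : ℝ → ℝ} (hG : Continuous G) (hGf : ∀ u, 0 ≤ u → G u = f u) :
    IsSolR a b f y ↔ Continuous y ∧ (∀ t, 0 ≤ y t) ∧ Sol a b G y univ := by
  unfold IsSolR
  refine and_congr_right fun cy => and_congr_right fun py => ?_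
  have hfun : ∀ t, (fun s => Real.exp (-a * (t - s)) * f (y (s - 1))) =
      fun s => Real.exp (-(a * t)) * (Real.exp (a * s) * G (y (s - 1))) := by
    intro t; funext s
    rw [hGf _ (py _), ← mul_assoc, ← Real.exp_add]
    ring_nf
  have hE : ∀ t, Real.exp (a * t) * Real.exp (-(a * t)) = 1 := fun t => by rw [← Real.exp_add]; simp
  have hE2 : ∀ τ t, Real.exp (-a * (t - τ)) = Real.exp (-(a * t)) * Real.exp (a * τ) := fun τ t => by
    rw [← Real.exp_add]; ring_nf
  constructor
  · intro h τ _ t _ hle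
    rcases hle.lt_or_eq with hlt | heq
    · have h1 := (h τ t hlt).2
      rw [hfun, intervalIntegral.integral_const_mul, hE2] at h1
      linear_combination Real.exp (a * t) * h1 + (Real.exp (a * τ) * y τ + b * ∫ s in τ..t, Real.exp (a * s) * G (y (s - 1))) * hE t
    · rw [heq]; simp
  · intro h τ t hlt
    rw [hfun]
    refine ⟨Continuous.intervalIntegrable (by fun_prop) _ _, ?_⟩
    have h1 := h τ trivial t trivial hlt.le
    rw [intervalIntegral.integral_const_mul, hE2]
    linear_combination Real.exp (-(a * t)) * h1 - y t * hE t

/-- the data for one fixed `n` -/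
structure Core (a b r ξ : ℝ) (f f' : ℝ → ℝ) : Prop where
  ha : 0 < a
  hb : 0 < b
  hr : ξ < r
  hξ0 : 0 < ξ
  hξ : a * ξ = b * f ξ
  maps : ∀ u, 0 ≤ u → f u ∈ Ico (0:ℝ) 1
  hd : ∀ u, 0 ≤ u → HasDerivWithinAt f (f' u) (Ici 0) u
  hc : ContinuousOn f' (Ici 0)
  f0 : f 0 = 0
  fpos : ∀ u, 0 < u → u ≤ r → 0 ≤ f' u
  slope : a < b * f' ξ
  up : ∀ u, ξ < u → u ≤ r → a * u < b * f u
  dn : ∀ u, 0 < u → u < ξ → b * f u < a * u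

namespace Core

variable {a b r ξ : ℝ} {f f' : ℝ → ℝ}

lemma mvt (h : Core a b r ξ f f') {u v : ℝ} (hu : 0 ≤ u) (huv : u < v) :
    ∃ c ∈ Ioo u v, f v - f u = f' c * (v - u) := by
  have hcont : ContinuousOn f (Icc u v) := fun x hx =>
    ((h.hd x (hu.trans hx.1)).continuousWithinAt).mono (fun y hy => hu.trans hy.1)
  obtain ⟨c, hc, e⟩ := exists_hasDerivAt_eq_slope f f' huv hcont (fun x hx =>
    (h.hd x (hu.trans hx.1.le)).hasDerivAt (Ici_mem_nhds (lt_of_le_of_lt hu hx.1)))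
  refine ⟨c, hc, ?_⟩
  rw [e]; field_simp [sub_ne_zero.2 huv.ne']

lemma cont0 (h : Core a b r ξ f f') : Continuous (fun u => f (max u 0)) := by
  have : ContinuousOn f (Ici 0) := fun x hx => (h.hd x hx).continuousWithinAt
  exact this.comp_continuous (by fun_prop) (fun u => le_max_right u 0)

/-- truncated nonlinearity -/
def F (r : ℝ) (f : ℝ → ℝ) : ℝ → ℝ := fun u => f (max (min u r) 0)

lemma r0 (h : Core a b r ξ f f') : 0 < r := h.hξ0.trans h.hr

lemma F_eq (f : ℝ → ℝ) {u : ℝ} (h0 : 0 ≤ u) (h1 : u ≤ r) : F r f u = f u := by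
  simp [F, h0, h1]

lemma F_mono (h : Core a b r ξ f f') : Monotone (F r f) := by
  have hm : ∀ u v, 0 ≤ u → u ≤ v → v ≤ r → f u ≤ f v := by
    intro u v h0 h1 h2
    rcases h1.lt_or_eq with hlt | heq
    · obtain ⟨c, hc, e⟩ := h.mvt h0 hlt
      have := h.fpos c (h0.trans_lt hc.1) (hc.2.le.trans h2)
      have : 0 ≤ f' c * (v - u) := mul_nonneg this (by linarith)
      linarith
    · rw [heq]
  intro u v huv
  exact hm _ _ (le_max_right _ _) (by gcongr) (max_le (min_le_right _ _) h.r0.le)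

lemma F_lip (h : Core a b r ξ f f') : ∃ L₀, 0 ≤ L₀ ∧ ∀ u v, |F r f u - F r f v| ≤ L₀ * |u - v| := by
  obtain ⟨B, hB⟩ := (isCompact_Icc (a := (0:ℝ)) (b := r)).exists_bound_of_continuousOn
    (h.hc.mono (fun x hx => hx.1))
  have hB0 : 0 ≤ B := (norm_nonneg _).trans (hB 0 ⟨le_rfl, h.r0.le⟩)
  have h1 : ∀ u v, 0 ≤ u → u ≤ v → v ≤ r → |f u - f v| ≤ B * |u - v| := by
    intro u v h0 h1 h2
    rcases h1.lt_or_eq with hlt | heq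
    · obtain ⟨c, hc, e⟩ := h.mvt h0 hlt
      rw [abs_sub_comm, e, abs_mul, abs_sub_comm u]
      gcongr
      exact hB c ⟨h0.trans hc.1.le, hc.2.le.trans h2⟩
    · simp [heq]
  have h2 : ∀ u v, u ≤ v → |F r f u - F r f v| ≤ B * |u - v| := by
    intro u v huv
    refine (h1 _ _ (le_max_right _ _) (by gcongr) (max_le (min_le_right _ _) h.r0.le)).trans ?_
    refine mul_le_mul_of_nonneg_left ?_ (by positivity)
    refine (abs_max_sub_max_le_abs (min u r) (min v r) 0).trans ?_
    refine (abs_min_sub_min_le_max u r v r).trans ?_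
    simp
  refine ⟨B, hB0, fun u v => ?_⟩
  rcases le_total u v with h3 | h3
  · exact h2 u v h3
  · rw [abs_sub_comm, abs_sub_comm u]; exact h2 v u h3

lemma F_cont (h : Core a b r ξ f f') : Continuous (F r f) := 
  h.cont0.comp (by fun_prop : Continuous fun u : ℝ => min u r)

lemma F_slope (h : Core a b r ξ f f') {ℓ L : ℝ} (hℓ : ℓ < f' ξ) (hL : f' ξ < L) :
    ∃ δ > 0, ∀ u v, ξ - δ ≤ u → u ≤ v → v ≤ ξ + δ → 
      ℓ * (v - u) ≤ F r f v - F r f u ∧ F r f v - F r f u ≤ L * (v - u) := by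
  have hcont : ContinuousAt f' ξ := h.hc.continuousAt (Ici_mem_nhds h.hξ0)
  have ev : ∀ᶠ x in 𝓝 ξ, f' x ∈ Ioo ℓ L ∧ x ∈ Ioo 0 r :=
    (hcont.eventually (Ioo_mem_nhds hℓ hL)).and (Ioo_mem_nhds h.hξ0 h.hr)
  obtain ⟨δ, hδ, hball⟩ := Metric.eventually_nhds_iff.1 ev
  have hb : ∀ x, ξ - δ / 2 ≤ x → x ≤ ξ + δ / 2 → f' x ∈ Ioo ℓ L ∧ x ∈ Ioo 0 r := by
    intro x h1 h2
    apply hball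
    rw [Real.dist_eq, abs_lt]; constructor <;> linarith
  refine ⟨δ / 2, by positivity, fun u v h1 h2 h3 => ?_⟩
  have hu := (hb u h1 (by linarith)).2
  have hv := (hb v (by linarith) h3).2
  rw [F_eq f hu.1.le hu.2.le, F_eq f hv.1.le hv.2.le]
  rcases h2.lt_or_eq with hlt | heq
  · obtain ⟨c, hc, e⟩ := h.mvt hu.1.le hlt
    have := (hb c (by linarith [hc.1]) (by linarith [hc.2])).1
    rw [e]
    constructor <;> gcongr
    · exact this.1.le
    · exact this.2.le
  · simp [heq]

/-- uniqueness in terms of the shifted and reflected equation, `σ = ±1` -/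
lemma uniq (h : Core a b r ξ f f') {σ : ℝ} (hσ : σ = 1 ∨ σ = -1) {y₁ y₂ : ℝ → ℝ}
    (s₁ : Sol a b (fun u => f (max u 0)) y₁ univ) (s₂ : Sol a b (fun u => f (max u 0)) y₂ univ)
    (c₁ : Continuous y₁) (c₂ : Continuous y₂)
    (m₁ : MonotoneOn (fun t => σ * y₁ t) (Iic 0)) (m₂ : MonotoneOn (fun t => σ * y₂ t) (Iic 0))
    (b₁ : ∀ t ≤ 0, y₁ t ∈ Icc 0 r) (b₂ : ∀ t ≤ 0, y₂ t ∈ Icc 0 r)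
    (l₁ : Tendsto y₁ atBot (𝓝 ξ)) (l₂ : Tendsto y₂ atBot (𝓝 ξ)) (h0 : y₁ 0 = y₂ 0) : y₁ = y₂ := by
  have hσ2 : σ * σ = 1 := by rcases hσ with rfl | rfl <;> norm_num
  have hσ0 : σ ≠ 0 := by rcases hσ with rfl | rfl <;> norm_num
  obtain ⟨μ, ℓ, L, hμ, hℓ, hL, hbℓ, hbL⟩ := exists_mu h.ha h.hb h.slope
  obtain ⟨δ, hδ, hs⟩ := h.F_slope hℓ hL
  have hFξ : F r f ξ = f ξ := F_eq f h.hξ0.le h.hr.le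
  have hFc := h.F_cont
  let H : ℝ → ℝ := fun u => σ * (F r f (ξ + σ * u) - f ξ)
  have Hc : Continuous H := by
    show Continuous fun u => σ * (F r f (ξ + σ * u) - f ξ)
    fun_prop
  have Hm : Monotone H := by
    intro u v huv
    rcases hσ with rfl | rfl
    · have := h.F_mono (show ξ + 1 * u ≤ ξ + 1 * v by linarith)
      simp only [H]; linarith
    · have := h.F_mono (show ξ + -1 * v ≤ ξ + -1 * u by linarith)
      simp only [H]; linarith
  have Hs : ∀ u v, 0 ≤ u → u ≤ v → v ≤ δ → ℓ * (v - u) ≤ H v - H u ∧ H v - H u ≤ L * (v - u) := by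
    intro u v h1 h2 h3
    rcases hσ with rfl | rfl
    · have := hs (ξ + 1 * u) (ξ + 1 * v) (by linarith) (by linarith) (by linarith)
      simp only [H]; constructor <;> linarith
    · have := hs (ξ + -1 * v) (ξ + -1 * u) (by linarith) (by linarith) (by linarith)
      simp only [H]; constructor <;> linarith
  have H0 : H 0 = 0 := by simp [H, hFξ]
  have hL0 : 0 ≤ L := by
    have : 0 < f' ξ := by
      by_contra hcon
      push Not at hcon
      nlinarith [h.slope, h.ha, h.hb]
    linarith
  have conv : ∀ y : ℝ → ℝ, Continuous y → Sol a b (fun u => f (max u 0)) y univ → (∀ t ≤ 0, y t ∈ Icc 0 r) →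
      Sol a b H (fun t => σ * (y t - ξ)) (Iic 0) := by
    intro y cy sy by'
    have e : ∀ t, ξ + σ * (σ * (y t - ξ)) = y t := fun t => by
      linear_combination (y t - ξ) * hσ2
    rw [Sol.affine (G := F r f) (y := y) (ξ := ξ) h.ha hσ0 ordConnected_Iic Hc (by fun_prop) (by rw [hFξ]; exact h.hξ) (fun t _ => (e t).symm)]
    · refine Sol.congr ordConnected_Iic (sy.mono (subset_univ _)) (fun _ _ => rfl) ?_
      intro s hs
      have := by' (s - 1) (by linarith [mem_Iic.1 hs])
      rw [F_eq f this.1 this.2, max_eq_left this.1]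
    · intro s _
      simp only [H]
      rw [e, hFξ]
      linear_combination -(F r f (y (s-1)) - f ξ) * hσ2
  have mono' : ∀ y : ℝ → ℝ, MonotoneOn (fun t => σ * y t) (Iic 0) → MonotoneOn (fun t => σ * (y t - ξ)) (Iic 0) := by
    intro y hy s hs t ht hst
    have := hy hs ht hst
    simp only at this ⊢
    linarith
  have lim' : ∀ y : ℝ → ℝ, Tendsto y atBot (𝓝 ξ) → Tendsto (fun t => σ * (y t - ξ)) atBot (𝓝 0) := by
    intro y hy
    have := (hy.sub_const ξ).const_mul σ
    simpa using this
  have pos' : ∀ y : ℝ → ℝ, MonotoneOn (fun t => σ * (y t - ξ)) (Iic 0) → Tendsto (fun t => σ * (y t - ξ)) atBot (𝓝 0) →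
      ∀ t ≤ 0, 0 ≤ σ * (y t - ξ) := by
    intro y hy hl t ht
    refine le_of_tendsto hl ?_
    filter_upwards [eventually_le_atBot t] with s hs
    exact hy (hs.trans ht) ht hs
  obtain ⟨T, hT⟩ := uniq_back (ℓ := ℓ) (L := L) (μ := μ) (δ := δ) h.ha h.hb hμ hδ Hc Hm (by fun_prop) (by fun_prop)
    (conv y₁ c₁ s₁ b₁) (conv y₂ c₂ s₂ b₂) (mono' _ m₁) (mono' _ m₂)
    (pos' _ (mono' _ m₁) (lim' _ l₁)) (pos' _ (mono' _ m₂) (lim' _ l₂)) (lim' _ l₁) (lim' _ l₂)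
    (by simp only [h0]) (fun u h1 h2 => by
      have := (Hs 0 u le_rfl h1 h2).1
      rw [H0] at this; linarith) hL0 (fun u v h1 h2 h3 h4 => by
      have aux : ∀ u v, 0 ≤ u → u ≤ v → v ≤ δ → |H u - H v| ≤ L * |u - v| := by
        intro u v h1 h2 h3
        rw [abs_of_nonpos (by linarith [Hm h2]), abs_of_nonpos (by linarith)]
        linarith [(Hs u v h1 h2 h3).2]
      rcases le_total u v with h5 | h5
      · exact aux u v h1 h5 h4
      · rw [abs_sub_comm, abs_sub_comm u]; exact aux v u h3 h5 h2) hbℓ hbL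
  refine uniq_fwd s₁ s₂ (T := T) fun t ht => ?_
  have := mul_left_cancel₀ hσ0 (hT t ht)
  linarith

lemma plus (h : Core a b r ξ f f') {κ M : ℝ} (hκ : 0 < κ) (hκr : κ + ξ ≤ r) (hM : κ + ξ < M) (hbM : b < a * M) :
    ∃ y, YPlusSpec a b κ ξ M f y ∧ ∀ y', YPlusSpec a b κ ξ M f y' → y' = y := by
  have hFξ : F r f ξ = f ξ := F_eq f h.hξ0.le h.hr.le
  have hFc := h.F_cont
  have ha := h.ha
  have hb := h.hb
  have c0 := h.cont0
  have huniq : ∀ y y', YPlusSpec a b κ ξ M f y → YPlusSpec a b κ ξ M f y' → y' = y := by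
    intro y y' hy hy'
    have bd : ∀ y, YPlusSpec a b κ ξ M f y → ∀ t ≤ 0, y t ∈ Icc 0 r := by
      rintro y ⟨_, hm, h0, _, hb⟩ t ht
      refine ⟨(hb t).1.le, ?_⟩
      have := hm.monotoneOn ht (mem_Iic.2 le_rfl) ht
      linarith
    have i := (isSolR_iff (G := fun u => f (max u 0)) c0 (fun u hu => by simp [hu])).1 hy.1
    have i' := (isSolR_iff (G := fun u => f (max u 0)) c0 (fun u hu => by simp [hu])).1 hy'.1
    exact h.uniq (σ := 1) (Or.inl rfl) i'.2.2 i.2.2 i'.1 i.1 (by simpa using hy'.2.1.monotoneOn)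
      (by simpa using hy.2.1.monotoneOn) (bd _ hy') (bd _ hy) hy'.2.2.2.1 hy.2.2.2.1
      (by rw [hy.2.2.1, hy'.2.2.1])
  suffices hex : ∃ y, YPlusSpec a b κ ξ M f y by
    obtain ⟨y, hy⟩ := hex
    exact ⟨y, hy, fun y' hy' => huniq y y' hy hy'⟩
  obtain ⟨L₀, hL₀, hL⟩ := h.F_lip
  have hfr : 0 ≤ f r := (h.maps r h.r0.le).1
  obtain ⟨u, uc, us, um, u0, ul, -⟩ := exists_het (a := a) (b := b) (K := κ) (M := max κ (b * (f r - f ξ) / a)) (L₀ := L₀)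
    (H := fun u => F r f (ξ + u) - f ξ) ha hb
    (fun u v huv => by
      have := h.F_mono (show ξ + u ≤ ξ + v by linarith)
      simp only; linarith) (by fun_prop) hL₀
    (fun u v => by
      have := hL (ξ + u) (ξ + v)
      simpa using this) (by simp [hFξ]) hκ (le_max_left _ _)
    (by
      have h1 : F r f (ξ + max κ (b * (f r - f ξ) / a)) ≤ f r := by
        have := h.F_mono (le_max_left (ξ + max κ (b * (f r - f ξ) / a)) r)
        refine this.trans (le_of_eq ?_)
        simp [F, h.r0.le]
      have h2 : b * (f r - f ξ) ≤ a * max κ (b * (f r - f ξ) / a) := by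
        calc b * (f r - f ξ) = a * (b * (f r - f ξ) / a) := by field_simp
          _ ≤ _ := by gcongr; exact le_max_right _ _
      refine le_trans ?_ h2
      gcongr)
    (fun u h1 h2 => by
      have h3 := h.up (ξ + u) (by linarith) (by linarith)
      rw [F_eq f (by linarith [h.hξ0]) (by linarith)]
      have := h.hξ
      linarith)
  have upos : ∀ t, 0 ≤ u t := by
    intro t
    refine le_of_tendsto ul ?_
    filter_upwards [eventually_le_atBot t] with s hs
    exact um.monotone hs
  obtain ⟨y, yc, y0, ys⟩ := exists_ext (a := a) (b := b) c0 (φ := fun t => ξ + 1 * u t) (by fun_prop)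
  have s1 : Sol a b (F r f) (fun t => ξ + 1 * u t) univ := by
    refine (Sol.affine (σ := 1) (ξ := ξ) ha one_ne_zero ordConnected_univ (by fun_prop) uc (by rw [hFξ]; exact h.hξ) (fun t _ => rfl) ?_).1 us
    intro s _
    simp [hFξ]
  have ule : ∀ t ≤ 0, u t ≤ κ := fun t ht => by rw [← u0]; exact um.monotone ht
  have s2 : Sol a b (fun u => f (max u 0)) y (Iic 0) := by
    refine Sol.congr ordConnected_Iic (s1.mono (subset_univ _)) (fun t ht => (y0 t ht).symm) ?_
    intro s hs
    have hs' : s - 1 ≤ 0 := by linarith [mem_Iic.1 hs]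
    have h1 := ule (s - 1) hs'
    have h2 := upos (s - 1)
    have h3 := h.hξ0
    rw [y0 _ hs', F_eq f (by linarith) (by linarith), max_eq_left (by linarith)]
  have s3 := Sol.concat c0 yc s2 ys
  have y00 : y 0 = κ + ξ := by rw [y0 0 le_rfl, u0]; ring
  have fb : ∀ s, f (max (y (s - 1)) 0) ∈ Ico (0:ℝ) 1 := fun s => h.maps _ (le_max_right _ _)
  have ybd : ∀ t, y t ∈ Ioo 0 M := by
    intro t
    have hξ0 := h.hξ0
    rcases le_total t 0 with ht | ht
    · have h1 := ule t ht
      have h2 := upos t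
      rw [y0 t ht]
      constructor <;> linarith
    · have e := ys 0 (by simp) t ht ht
      rw [y00, mul_zero, Real.exp_zero, one_mul] at e
      have i1 : 0 ≤ ∫ s in (0:ℝ)..t, Real.exp (a * s) * f (max (y (s - 1)) 0) :=
        intervalIntegral.integral_nonneg ht fun s _ => mul_nonneg (Real.exp_pos _).le (fb s).1
      have i2 : ∫ s in (0:ℝ)..t, Real.exp (a * s) * f (max (y (s - 1)) 0) ≤ ∫ s in (0:ℝ)..t, Real.exp (a * s) := by
        apply intervalIntegral.integral_mono_on ht ((cont_int c0 yc).intervalIntegrable _ _) (Continuous.intervalIntegrable (by fun_prop) _ _)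
        intro s _
        have := (fb s).2.le
        have := Real.exp_pos (a * s)
        nlinarith
      rw [int_exp _ _ _ ha.ne', mul_zero, Real.exp_zero] at i2
      have hE : 1 ≤ Real.exp (a * t) := Real.one_le_exp (by positivity)
      constructor
      · have h1 : 0 < Real.exp (a * t) * y t := by
          rw [e]
          have := mul_nonneg hb.le i1
          linarith
        exact pos_of_mul_pos_right h1 (Real.exp_pos _).le
      · have h1 := mul_le_mul_of_nonneg_left i2 hb.le
        have h2 : b * ((Real.exp (a * t) - 1) / a) ≤ M * (Real.exp (a * t) - 1) := by
          have : b / a ≤ M := by rw [div_le_iff₀ ha]; linarith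
          calc b * ((Real.exp (a * t) - 1) / a) = b / a * (Real.exp (a * t) - 1) := by ring
            _ ≤ _ := by gcongr
        have h3 : Real.exp (a * t) * y t < Real.exp (a * t) * M := by
          rw [e]; linarith
        exact lt_of_mul_lt_mul_left h3 (Real.exp_pos _).le
  refine ⟨y, (isSolR_iff c0 (fun u hu => by simp [hu])).2 ⟨yc, fun t => (ybd t).1.le, s3⟩, ?_, y00, ?_, ybd⟩
  · intro s hs t ht hst
    rw [y0 s hs, y0 t ht]
    linarith [um hst]
  · have : Tendsto (fun t => ξ + 1 * u t) atBot (𝓝 ξ) := by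
      simpa using ul.const_add ξ
    refine this.congr' ?_
    filter_upwards [eventually_le_atBot 0] with t ht
    exact (y0 t ht).symm

lemma minus (h : Core a b r ξ f f') {κ : ℝ} (hκ : κ < 0) (hκξ : -ξ < κ) :
    ∃ y, YMinusSpec a b κ ξ f y ∧ ∀ y', YMinusSpec a b κ ξ f y' → y' = y := by
  have hFξ : F r f ξ = f ξ := F_eq f h.hξ0.le h.hr.le
  have hF0 : F r f 0 = 0 := by rw [F_eq f le_rfl h.r0.le, h.f0]
  have hFc := h.F_cont
  have ha := h.ha
  have hb := h.hb
  have c0 := h.cont0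
  have hξr := h.hr
  have huniq : ∀ y y', YMinusSpec a b κ ξ f y → YMinusSpec a b κ ξ f y' → y' = y := by
    intro y y' hy hy'
    have bd : ∀ y, YMinusSpec a b κ ξ f y → ∀ t ≤ 0, y t ∈ Icc 0 r := by
      rintro y ⟨_, _, hr, _⟩ t ht
      have : y t ∈ Ioo 0 ξ := hr ▸ mem_range_self t
      exact ⟨this.1.le, by linarith [this.2]⟩
    have md : ∀ y, YMinusSpec a b κ ξ f y → MonotoneOn (fun t => (-1) * y t) (Iic 0) := by
      rintro y ⟨_, hm, _⟩ s _ t _ hst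
      have := hm.antitone hst
      simp only; linarith
    have i := (isSolR_iff (G := fun u => f (max u 0)) c0 (fun u hu => by simp [hu])).1 hy.1
    have i' := (isSolR_iff (G := fun u => f (max u 0)) c0 (fun u hu => by simp [hu])).1 hy'.1
    exact h.uniq (σ := -1) (Or.inr rfl) i'.2.2 i.2.2 i'.1 i.1 (md _ hy')
      (md _ hy) (bd _ hy') (bd _ hy) hy'.2.2.2.2.1 hy.2.2.2.2.1
      (by rw [hy.2.2.2.1, hy'.2.2.2.1])
  suffices hex : ∃ y, YMinusSpec a b κ ξ f y by
    obtain ⟨y, hy⟩ := hex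
    exact ⟨y, hy, fun y' hy' => huniq y y' hy hy'⟩
  obtain ⟨L₀, hL₀, hL⟩ := h.F_lip
  have Hm : Monotone (fun u => f ξ - F r f (ξ - u)) := fun u v huv => by
      have := h.F_mono (show ξ - v ≤ ξ - u by linarith)
      simp only; linarith
  have Hc : Continuous (fun u => f ξ - F r f (ξ - u)) := by fun_prop
  have Hpos : ∀ u, 0 < u → u < ξ → a * u < b * (f ξ - F r f (ξ - u)) := fun u h1 h2 => by
      have h3 := h.dn (ξ - u) (by linarith) (by linarith)
      rw [F_eq f (by linarith) (by linarith)]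
      have := h.hξ
      linarith
  obtain ⟨u, uc, us, um, u0, ul, uM⟩ := exists_het (a := a) (b := b) (K := -κ) (M := ξ) (L₀ := L₀)
    (H := fun u => f ξ - F r f (ξ - u)) ha hb Hm Hc hL₀
    (fun u v => by
      have := hL (ξ - v) (ξ - u)
      rw [show f ξ - F r f (ξ - u) - (f ξ - F r f (ξ - v)) = F r f (ξ - v) - F r f (ξ - u) by ring]
      rwa [show ξ - v - (ξ - u) = u - v by ring] at this) (by simp [hFξ]) (by linarith) (by linarith)
    (by simp [hF0, h.hξ])
    (fun u h1 h2 => Hpos u h1 (by linarith))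
  have upos : ∀ t, 0 < u t := by
    intro t
    refine lt_of_le_of_lt ?_ (um (show t - 1 < t by linarith))
    refine le_of_tendsto ul ?_
    filter_upwards [eventually_le_atBot (t - 1)] with s hs
    exact um.monotone hs
  have ult : ∀ t, u t < ξ := fun t => (um (show t < t + 1 by linarith)).trans_le (uM _)
  have utop : Tendsto u atTop (𝓝 ξ) := by
    have hbdd : BddAbove (range u) := ⟨ξ, by rintro _ ⟨t, rfl⟩; exact uM t⟩
    have h1 := tendsto_atTop_ciSup um.monotone hbdd
    set e := ⨆ t, u t with he
    have e0 : 0 < e := (upos 0).trans_le (le_ciSup hbdd 0)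
    have eξ : e ≤ ξ := ciSup_le uM
    have sh : ∀ r : ℝ, Tendsto (fun t => u (t - r)) atTop (𝓝 e) := fun r =>
      h1.comp (tendsto_atTop_add_const_right _ _ tendsto_id)
    have h3 : Real.exp (-a) * e + b * (f ξ - F r f (ξ - e)) * ((1 - Real.exp (-a)) / a) ≤ e := by
      refine le_of_tendsto_of_tendsto' ?_ h1 (mono_ineq ha hb Hm Hc uc us um.monotone)
      exact ((sh 1).const_mul _).add ((((Hc.tendsto _).comp (sh 2)).const_mul _).mul_const _)
    rcases eξ.lt_or_eq with hlt | heq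
    · exfalso
      have h4 := Hpos e e0 hlt
      have h5 : Real.exp (-a) < 1 := by rw [Real.exp_lt_one_iff]; linarith
      have h6 : a * e * ((1 - Real.exp (-a)) / a) < b * (f ξ - F r f (ξ - e)) * ((1 - Real.exp (-a)) / a) := by
        have : 0 < (1 - Real.exp (-a)) / a := div_pos (by linarith) ha
        gcongr
      have h7 : a * e * ((1 - Real.exp (-a)) / a) = e * (1 - Real.exp (-a)) := by field_simp
      linarith
    · rwa [heq] at h1
  have ys : Sol a b (F r f) (fun t => ξ + (-1) * u t) univ := by
    refine (Sol.affine (σ := -1) (ξ := ξ) ha (by norm_num) ordConnected_univ Hc uc (by rw [hFξ]; exact h.hξ) (fun t _ => rfl) ?_).1 us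
    intro s _
    simp only [hFξ]
    rw [show ξ + -1 * u (s - 1) = ξ - u (s - 1) by ring]
    ring
  have ys' : Sol a b (fun u => f (max u 0)) (fun t => ξ + (-1) * u t) univ := by
    refine ys.congr ordConnected_univ (fun _ _ => rfl) ?_
    intro s _
    have h1 := upos (s - 1)
    have h2 := ult (s - 1)
    rw [F_eq f (by linarith) (by linarith), max_eq_left (by linarith)]
  have yc : Continuous (fun t => ξ + (-1) * u t) := by fun_prop
  have tb : Tendsto (fun t => ξ + (-1) * u t) atBot (𝓝 ξ) := by
    simpa using (ul.const_mul (-1)).const_add ξ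
  have tt : Tendsto (fun t => ξ + (-1) * u t) atTop (𝓝 0) := by
    simpa using (utop.const_mul (-1)).const_add ξ
  refine ⟨fun t => ξ + (-1) * u t, (isSolR_iff c0 (fun u hu => by simp [hu])).2
    ⟨yc, fun t => by have := ult t; linarith, ys'⟩, ?_, ?_, ?_, tb, tt⟩
  · intro s t hst
    have := um hst
    simp only; linarith
  · apply Subset.antisymm
    · rintro _ ⟨t, rfl⟩
      have h1 := upos t
      have h2 := ult t
      constructor
      · simp only; linarith
      · simp only; linarith
    · intro z hz
      obtain ⟨t1, h1⟩ := (tt.eventually (Iio_mem_nhds hz.1)).exists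
      obtain ⟨t2, h2⟩ := (tb.eventually (Ioi_mem_nhds hz.2)).exists
      exact mem_range_of_exists_le_of_exists_ge yc ⟨t1, le_of_lt h1⟩ ⟨t2, le_of_lt h2⟩
  · simp only [u0]; ring

end Core

lemma g_ratio {g g' : ℝ → ℝ} (hg : CgA g g') {u v : ℝ} (hu : 0 < u) (huv : u < v) (hv : v ≤ 1) :
    g u / u < g v / v := by
  have hda : ∀ x ∈ Icc u v, HasDerivWithinAt (fun x => g x / x) ((g' x * x - g x * 1) / x ^ 2)
      (Icc u v) x := by
    intro x hx
    have hx0 : 0 < x := hu.trans_le hx.1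
    have h1 := (hg.hasDeriv x ⟨hx0.le, hx.2.trans hv⟩).mono
      (show Icc u v ⊆ Icc 0 1 from Icc_subset_Icc hu.le hv)
    exact h1.div (hasDerivWithinAt_id x _) hx0.ne'
  obtain ⟨w, hw, e⟩ := exists_hasDerivAt_eq_slope (fun x => g x / x)
    (fun x => (g' x * x - g x * 1) / x ^ 2) huv (fun x hx => (hda x hx).continuousWithinAt)
    (fun x hx => (hda x ⟨hx.1.le, hx.2.le⟩).hasDerivAt (Icc_mem_nhds hx.1 hx.2))
  have hw0 : 0 < w := hu.trans hw.1
  have hs := hg.slope w hw0 (hw.2.le.trans hv)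
  rw [div_lt_iff₀ hw0] at hs
  have hp : 0 < (g' w * w - g w * 1) / w ^ 2 := by
    apply div_pos _ (by positivity)
    linarith
  rw [e] at hp
  have := (div_pos_iff_of_pos_right (sub_pos.2 huv)).1 hp
  linarith

lemma mvt_icc {F F' : ℝ → ℝ} {s : Set ℝ} {u v : ℝ} (huv : u < v) (hs : Icc u v ⊆ s)
    (hF : ∀ x ∈ Icc u v, HasDerivWithinAt F (F' x) s x) :
    ∃ w ∈ Ioo u v, F v - F u = F' w * (v - u) := by
  obtain ⟨w, hw, e⟩ := exists_hasDerivAt_eq_slope F F' huv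
    (fun x hx => ((hF x hx).mono hs).continuousWithinAt)
    (fun x hx => ((hF x ⟨hx.1.le, hx.2.le⟩).mono hs).hasDerivAt (Icc_mem_nhds hx.1 hx.2))
  refine ⟨w, hw, ?_⟩
  rw [e, div_mul_cancel₀ _ (sub_pos.2 huv).ne']

/-- for all large `n` there are unique solutions `y^{-,n}, y^{+,n}` of
`(E_{f_n})` on `ℝ` with the listed properties. -/
theorem stmt_16 (c d : ℝ) (g g' : ℝ → ℝ) (hg : CgA g g') (hc : 0 < c) (hcd : c < d)
    (a b : ℕ → ℝ) (f f' : ℕ → ℝ → ℝ) (hf : Cfn c d g g' a b f f')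
    (ξ₁ : ℝ) (hξ₁ : ξ₁ ∈ Ioo (0:ℝ) 1) (hz₁ : -c * ξ₁ + d * g ξ₁ = 0)
    (κp κm : ℝ) (hκp : κp ∈ Ioo 0 (1 - ξ₁)) (hκm : κm ∈ Ioo (-ξ₁) 0)
    (ξ1n : ℕ → ℝ) (hξ1n : Tendsto ξ1n atTop (nhds ξ₁))
    (hξ1nz : ∀ᶠ n in atTop, 0 < ξ1n n ∧ -a n * ξ1n n + b n * f n (ξ1n n) = 0) :
    ∃ N : ℕ, ∀ n ≥ N,
      (∃ yp : ℝ → ℝ, YPlusSpec (a n) (b n) κp (ξ1n n) (2 * d / c) (f n) yp ∧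
        ∀ yp' : ℝ → ℝ, YPlusSpec (a n) (b n) κp (ξ1n n) (2 * d / c) (f n) yp' → yp' = yp) ∧
      (∃ ym : ℝ → ℝ, YMinusSpec (a n) (b n) κm (ξ1n n) (f n) ym ∧
        ∀ ym' : ℝ → ℝ, YMinusSpec (a n) (b n) κm (ξ1n n) (f n) ym' → ym' = ym) := by
  obtain ⟨hξ0, hξ1⟩ := hξ₁
  obtain ⟨hκp0, hκp1⟩ := hκp
  obtain ⟨hκm0, hκm1⟩ := hκm
  have hd : 0 < d := hc.trans hcd
  obtain ⟨r, hr1, hr2, hr3⟩ : ∃ r : ℝ, r < 1 ∧ 1 / 2 ≤ r ∧ ξ₁ + κp < r :=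
    ⟨max (1 / 2) ((1 + ξ₁ + κp) / 2), max_lt (by norm_num) (by linarith), le_max_left _ _,
      lt_of_lt_of_le (by linarith) (le_max_right _ _)⟩
  have hq : d * (g ξ₁ / ξ₁) = c := by
    field_simp
    linarith
  have hg'pos : ∀ x, 0 < x → x ≤ 1 → 0 < g' x := fun x h0 h1 =>
    lt_of_le_of_lt (div_nonneg (hg.maps_to x h0.le).1 h0.le) (hg.slope x h0 h1)
  have hge : ∀ x, ξ₁ ≤ x → x ≤ 1 → c < d * g' x := by
    intro x h0 h1
    have h2 : g ξ₁ / ξ₁ ≤ g x / x := by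
      rcases h0.lt_or_eq with h | h
      · exact (g_ratio hg hξ0 h h1).le
      · rw [h]
    have h3 := hg.slope x (hξ0.trans_le h0) h1
    have h4 : d * (g ξ₁ / ξ₁) < d * g' x := mul_lt_mul_of_pos_left (h2.trans_lt h3) hd
    linarith
  obtain ⟨p, hp0, hpξ, hp⟩ : ∃ p : ℝ, 0 < p ∧ p < ξ₁ ∧ ∀ x ∈ Icc p r, c < d * g' x := by
    have hct : ContinuousAt g' ξ₁ := hg.derivCont.continuousAt (Icc_mem_nhds hξ0 hξ1)
    have hev : ∀ᶠ x in 𝓝 ξ₁, c < d * g' x :=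
      (hct.const_mul d).eventually (lt_mem_nhds (hge ξ₁ le_rfl hξ1.le))
    obtain ⟨δ, hδ, hδ'⟩ := Metric.eventually_nhds_iff.1 hev
    refine ⟨max (ξ₁ / 2) (ξ₁ - δ / 2), lt_max_of_lt_left (by linarith),
      max_lt (by linarith) (by linarith), fun x hx => ?_⟩
    rcases le_or_gt ξ₁ x with h | h
    · exact hge x h (hx.2.trans hr1.le)
    · apply hδ'
      have := (le_max_right _ _).trans hx.1
      rw [Real.dist_eq, abs_lt]
      constructor <;> linarith
  have hpr : p ≤ r := by linarith
  obtain ⟨x0, hx0, hx0m⟩ := (isCompact_Icc (a := p) (b := r)).exists_isMinOn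
    ⟨p, le_rfl, hpr⟩ (hg.derivCont.mono (Icc_subset_Icc hp0.le hr1.le))
  obtain ⟨x1, hx1, hx1m⟩ := (isCompact_Icc (a := (1/2 : ℝ)) (b := r)).exists_isMinOn
    ⟨1/2, le_rfl, hr2⟩ (hg.derivCont.mono (Icc_subset_Icc (by norm_num) hr1.le))
  have hm := hp x0 hx0
  have hm1 : 0 < g' x1 := hg'pos x1 (by linarith [hx1.1]) (by linarith [hx1.2])
  have hq1 : d * (g p / p) < c := by
    rw [← hq]
    exact mul_lt_mul_of_pos_left (g_ratio hg hp0 hpξ hξ1.le) hd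
  obtain ⟨ε, hε, hε1, hε2, hε3⟩ : ∃ ε : ℝ, 0 < ε ∧ c < d * (g' x0 - ε) ∧ ε ≤ g' x1 ∧
      d * (g p / p + ε) < c := by
    set e1 := (d * g' x0 - c) / (2 * d) with he1
    set e2 := (c - d * (g p / p)) / (2 * d) with he2
    have h1 : 0 < e1 := div_pos (by linarith) (by linarith)
    have h2 : 0 < e2 := div_pos (by linarith) (by linarith)
    have h1' : d * e1 = (d * g' x0 - c) / 2 := by rw [he1]; field_simp
    have h2' : d * e2 = (c - d * (g p / p)) / 2 := by rw [he2]; field_simp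
    refine ⟨min (g' x1) (min e1 e2), lt_min hm1 (lt_min h1 h2), ?_, min_le_left _ _, ?_⟩
    · have : d * min (g' x1) (min e1 e2) ≤ d * e1 :=
        mul_le_mul_of_nonneg_left ((min_le_right _ _).trans (min_le_left _ _)) hd.le
      rw [mul_sub]; linarith
    · have : d * min (g' x1) (min e1 e2) ≤ d * e2 :=
        mul_le_mul_of_nonneg_left ((min_le_right _ _).trans (min_le_right _ _)) hd.le
      rw [mul_add]; linarith
  have hcl : ∀ᶠ n in atTop, ∀ x ∈ Icc (0:ℝ) r, |f n x - g x| + |f' n x - g' x| < ε := by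
    obtain ⟨N, hN⟩ := hf.close (1 - r) (by linarith) (by linarith) ε hε
    filter_upwards [eventually_ge_atTop N] with n hn x hx
    exact hN n hn x (Or.inl (by simpa using hx))
  have hA : ∀ᶠ n in atTop, a n < b n * (g' x0 - ε) :=
    hf.a_lim.eventually_lt (hf.b_lim.mul_const _) hε1
  have hB : ∀ᶠ n in atTop, b n * (g p / p + ε) < a n :=
    (hf.b_lim.mul_const _).eventually_lt hf.a_lim hε3
  have hC : ∀ᶠ n in atTop, b n < a n * (2 * d / c) := by
    refine hf.b_lim.eventually_lt (hf.a_lim.mul_const _) ?_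
    rw [mul_div_cancel₀ _ hc.ne']
    linarith
  have hD := hξ1n.eventually (Ioo_mem_nhds hpξ (show ξ₁ < r - κp by linarith))
  have hE := hξ1n.eventually (lt_mem_nhds (show -κm < ξ₁ by linarith))
  apply eventually_atTop.1
  filter_upwards [hcl, hA, hB, hC, hD, hE, hξ1nz] with n hcl hA hB hC hD hE hz
  obtain ⟨hD1, hD2⟩ := hD
  obtain ⟨hz0, hz1⟩ := hz
  have hf'c : ∀ x ∈ Icc (0:ℝ) r, |f' n x - g' x| < ε := fun x hx => by
    have := hcl x hx
    have := abs_nonneg (f n x - g x)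
    linarith
  have hb := hf.b_pos n
  have hsl : ∀ x ∈ Icc p r, a n < b n * f' n x := by
    intro x hx
    have h1 := (abs_lt.1 (hf'c x ⟨hp0.le.trans hx.1, hx.2⟩)).1
    have h2 : g' x0 ≤ g' x := hx0m hx
    exact hA.trans (mul_lt_mul_of_pos_left (by linarith) hb)
  have hinc : ∀ u v, p ≤ u → u < v → v ≤ r → a n * (v - u) < b n * (f n v - f n u) := by
    intro u v h1 h2 h3
    obtain ⟨w, hw, e⟩ := mvt_icc (s := Ici 0) h2 (fun x hx => hp0.le.trans (h1.trans hx.1))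
      (fun x hx => hf.hasDeriv n x (hp0.le.trans (h1.trans hx.1)))
    rw [e, ← mul_assoc]
    exact mul_lt_mul_of_pos_right (hsl w ⟨h1.trans hw.1.le, hw.2.le.trans h3⟩) (sub_pos.2 h2)
  have hcore : Core (a n) (b n) r (ξ1n n) (f n) (f' n) := by
    refine ⟨hf.a_pos n, hb, by linarith, hz0, by linarith, hf.maps_to n, hf.hasDeriv n,
      hf.derivCont n, hf.f_zero n, ?_, hsl _ ⟨hD1.le, by linarith⟩, ?_, ?_⟩
    · intro u h0 h1
      rcases le_or_gt u (1/2) with h | h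
      · exact (hf.f'_pos n u h0 h).le
      · have h2 := (abs_lt.1 (hf'c u ⟨h0.le, h1⟩)).1
        have h3 : g' x1 ≤ g' u := hx1m ⟨h.le, h1⟩
        linarith
    · intro u h0 h1
      have := hinc (ξ1n n) u hD1.le h0 h1
      rw [mul_sub, mul_sub] at this
      linarith
    · intro u h0 h1
      rcases le_or_gt p u with h | h
      · have := hinc u (ξ1n n) h h1 (by linarith)
        rw [mul_sub, mul_sub] at this
        linarith
      · obtain ⟨w, hw, e⟩ := mvt_icc (F := fun x => f n x - g x) (F' := fun x => f' n x - g' x)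
          (s := Icc 0 1) h0 (Icc_subset_Icc le_rfl (by linarith))
          (fun x hx => ((hf.hasDeriv n x hx.1).mono (fun y hy => hy.1)).sub
            (hg.hasDeriv x ⟨hx.1, by linarith [hx.2]⟩))
        have h2 := (abs_lt.1 (hf'c w ⟨hw.1.le, by linarith [hw.2]⟩)).2
        have h3 : (f' n w - g' w) * (u - 0) ≤ ε * u := by
          rw [sub_zero]
          exact mul_le_mul_of_nonneg_right h2.le h0.le
        have h4 := (g_ratio hg h0 h (by linarith)).le
        rw [div_le_iff₀ h0] at h4
        simp only [hf.f_zero n, hg.g_zero] at e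
        have h5 : f n u ≤ (g p / p + ε) * u := by
          rw [add_mul]; linarith
        calc b n * f n u ≤ b n * ((g p / p + ε) * u) := mul_le_mul_of_nonneg_left h5 hb.le
          _ = (b n * (g p / p + ε)) * u := by ring
          _ < a n * u := mul_lt_mul_of_pos_right hB h0
  have hM : 1 < 2 * d / c := by
    rw [lt_div_iff₀ hc]; linarith
  exact ⟨hcore.plus hκp0 (by linarith) (by linarith) hC, hcore.minus hκm1 (by linarith)⟩
end
end

section
/- Assume conditions (C_g)(a) (with d > c > 0) and (C_{f_n})(a)(b), fix κ⁺ ∈ (0, 1−ξ₁), let x⁺ be as in the standing definition, and assume condition (Y_n). Then sup_{j ∈ J_n} sup_{s ∈ [−1,0]} |Y^{+,n,j}(s) − x⁺(s)| → 0 as n → ∞. -/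
open Real Set Filter Topology MeasureTheory

noncomputable section

lemma exp_mono_aux (c : ℝ) (w h : ℝ → ℝ) (hw : Continuous w) (s t : ℝ) (hst : s ≤ t)
    (hd : ∀ x ∈ Ioo s t, HasDerivAt w (-c * w x + h x) x) (hh : ∀ x ∈ Ioo s t, 0 ≤ h x) :
    Real.exp (c * s) * w s ≤ Real.exp (c * t) * w t := by
  have hm : MonotoneOn (fun x => Real.exp (c * x) * w x) (Icc s t) := by
    have hD : ∀ x ∈ Ioo s t, HasDerivAt (fun x => Real.exp (c * x) * w x)
        (Real.exp (c * x) * h x) x := by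
      intro x hx
      have h1 : HasDerivAt (fun x => Real.exp (c * x)) (Real.exp (c * x) * (c * 1)) x :=
        ((hasDerivAt_id x).const_mul c).exp
      have := h1.mul (hd x hx)
      refine this.congr_deriv ?_
      ring
    apply monotoneOn_of_deriv_nonneg (convex_Icc s t)
    · exact (by fun_prop : Continuous (fun x => Real.exp (c * x) * w x)).continuousOn
    · intro x hx
      rw [interior_Icc] at hx
      exact (hD x hx).differentiableAt.differentiableWithinAt
    · intro x hx
      rw [interior_Icc] at hx
      rw [(hD x hx).deriv]
      exact mul_nonneg (Real.exp_pos _).le (hh x hx)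
  exact hm ⟨le_refl _, hst⟩ ⟨hst, le_refl _⟩ hst

lemma exp_mono_aux' (c : ℝ) (w h : ℝ → ℝ) (hw : Continuous w) (s t : ℝ) (hst : s ≤ t)
    (hd : ∀ x ∈ Ioo s t, HasDerivAt w (-c * w x + h x) x) (hh : ∀ x ∈ Ioo s t, 0 ≤ h x) :
    Real.exp (-(c * (t - s))) * w s ≤ w t := by
  have := exp_mono_aux c w h hw s t hst hd hh
  have e : Real.exp (-(c * (t - s))) = Real.exp (-(c * t)) * Real.exp (c * s) := by
    rw [← Real.exp_add]; congr 1; ring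
  calc _ = Real.exp (-(c * t)) * (Real.exp (c * s) * w s) := by rw [e]; ring
    _ ≤ Real.exp (-(c * t)) * (Real.exp (c * t) * w t) := by gcongr
    _ = w t := by rw [← mul_assoc, ← Real.exp_add]; simp

lemma contr_aux (c γ δ S T : ℝ) (hγ : 0 < γ) (hδ : 0 ≤ δ) (hS : 0 ≤ S)
    (u w α β : ℝ → ℝ) (hu : Continuous u) (hw : Continuous w) (hupos : ∀ t, 0 < u t)
    (hud : ∀ t < T, HasDerivAt u (-c * u t + α t) t)
    (hwd : ∀ t < T, HasDerivAt w (-c * w t + β t) t)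
    (hα : ∀ t < T, |α t - γ * u (t - 1)| ≤ δ * u (t - 1))
    (hβ : ∀ t < T, |β t - γ * w (t - 1)| ≤ δ * |w (t - 1)|)
    (hk : ∀ t < T, u (t - 1) ≤ Real.exp c * u t)
    (hwS : ∀ t ≤ T, |w t| ≤ S * u t)
    (hz : ∀ t ≤ T, ∃ t0 ∈ Icc (t - 1) t, w t0 = 0) :
    ∀ t ≤ T, w t ≤ S * (1 - Real.exp (-(Real.exp c * γ)) + 2 * δ / γ) * u t := by
  intro t ht
  obtain ⟨t0, ht0, hw0⟩ := hz t ht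
  set B := Real.exp c * γ with hB
  have hBpos : 0 < B := by positivity
  set q := 2 * δ * S / γ with hq
  have hq0 : 0 ≤ q := by positivity
  have key := exp_mono_aux' B (fun x => S - w x / u x + q)
    (fun x => -((-c * w x + β x) * u x - w x * (-c * u x + α x)) / u x ^ 2
        + B * (S - w x / u x + q))
    (by
      have : Continuous fun x => w x / u x := hw.div hu (fun x => (hupos x).ne')
      fun_prop) t0 t ht0.2 ?_ ?_
  · simp only [hw0, zero_div, sub_zero] at key
    have e1 : Real.exp (-B) ≤ Real.exp (-(B * (t - t0))) := by
      apply Real.exp_le_exp.2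
      have : t - t0 ≤ 1 := by linarith [ht0.1]
      nlinarith
    have e2 : Real.exp (-B) * S ≤ S - w t / u t + q := by
      have : Real.exp (-B) * (S + q) ≤ Real.exp (-(B * (t - t0))) * (S + q) := by gcongr
      nlinarith [Real.exp_pos (-B)]
    have e3 : w t / u t ≤ S * (1 - Real.exp (-B) + 2 * δ / γ) := by
      have : q = S * (2 * δ / γ) := by rw [hq]; ring
      nlinarith
    exact (div_le_iff₀ (hupos t)).1 e3
  · intro x hx
    have hxT : x < T := lt_of_lt_of_le hx.2 ht
    have := (((hwd x hxT).div (hud x hxT) (hupos x).ne').const_sub S).add_const q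
    refine this.congr_deriv ?_
    ring
  · intro x hx
    have hxT : x < T := lt_of_lt_of_le hx.2 ht
    have h1 := hα x hxT
    have h2 := hβ x hxT
    have h3 := hk x hxT
    have h4 := hwS x hxT.le
    have h5 := hwS (x - 1) (by linarith)
    have p0 := hupos x
    have p1 := hupos (x - 1)
    set u0 := u x
    set u1 := u (x - 1)
    set w0 := w x
    set w1 := w (x - 1)
    have a1 : β x ≤ γ * (S * u1) + δ * (S * u1) := by
      have : δ * |w1| ≤ δ * (S * u1) := by gcongr
      have : γ * w1 ≤ γ * (S * u1) := by gcongr; exact (le_abs_self _).trans h5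
      linarith [(abs_le.1 h2).2]
    have a2 : -(w0 * α x) ≤ -(γ * w0 * u1) + δ * (S * u0) * u1 := by
      have : -(w0 * (α x - γ * u1)) ≤ |w0| * |α x - γ * u1| := by
        rw [← abs_mul]; exact neg_le_abs _
      have : |w0| * |α x - γ * u1| ≤ (S * u0) * (δ * u1) := by gcongr
      nlinarith
    have a3 : β x * u0 ≤ (γ * (S * u1) + δ * (S * u1)) * u0 := by gcongr
    have a4 : 0 ≤ γ * (S * u0 - w0) + 2 * δ * S * u0 := by
      have : w0 ≤ S * u0 := (le_abs_self _).trans h4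
      have : 0 ≤ S * u0 - w0 := by linarith
      positivity
    have a5 : u1 * (γ * (S * u0 - w0) + 2 * δ * S * u0) ≤
        Real.exp c * u0 * (γ * (S * u0 - w0) + 2 * δ * S * u0) := by gcongr
    have a6 : β x * u0 - w0 * α x ≤ Real.exp c * u0 * (γ * (S * u0 - w0) + 2 * δ * S * u0) := by
      nlinarith
    have : -((-c * w0 + β x) * u0 - w0 * (-c * u0 + α x)) / u0 ^ 2 + B * (S - w0 / u0 + q)
      = (Real.exp c * u0 * (γ * (S * u0 - w0) + 2 * δ * S * u0) - (β x * u0 - w0 * α x)) / u0 ^ 2 := by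
      rw [hB, hq]; field_simp; ring
    show 0 ≤ -((-c * w0 + β x) * u0 - w0 * (-c * u0 + α x)) / u0 ^ 2 + B * (S - w0 / u0 + q)
    rw [this]
    apply div_nonneg _ (sq_nonneg _)
    linarith

structure SolAux (c κ : ℝ) (G u : ℝ → ℝ) : Prop where
  cont : Continuous u
  nn : ∀ t, 0 ≤ u t
  le : ∀ t, u t ≤ κ
  u0 : u 0 = κ
  hd : ∀ t < 0, HasDerivAt u (-c * u t + G (u (t - 1))) t

structure GAux (c η P κ : ℝ) (G : ℝ → ℝ) : Prop where
  zero : G 0 = 0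
  lo : ∀ x y, 0 ≤ x → x ≤ y → y ≤ κ → (c + η) * (y - x) ≤ G y - G x
  hi : ∀ x y, 0 ≤ x → x ≤ y → y ≤ κ → G y - G x ≤ P * (y - x)

section
variable {c η P κ : ℝ} {G u v : ℝ → ℝ}

lemma SolAux.Gnn (hc : 0 < c) (hη : 0 < η) (hG : GAux c η P κ G) (hu : SolAux c κ G u) (t : ℝ) :
    (c + η) * u t ≤ G (u t) ∧ G (u t) ≤ P * u t ∧ 0 ≤ G (u t) := by
  have h1 := hG.lo 0 (u t) le_rfl (hu.nn t) (hu.le t)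
  have h2 := hG.hi 0 (u t) le_rfl (hu.nn t) (hu.le t)
  rw [hG.zero] at h1 h2
  simp only [sub_zero] at h1 h2
  exact ⟨h1, h2, le_trans (mul_nonneg (by linarith) (hu.nn t)) h1⟩

lemma SolAux.decay (hc : 0 < c) (hη : 0 < η) (hG : GAux c η P κ G) (hu : SolAux c κ G u)
    {s t : ℝ} (hst : s ≤ t) (ht : t ≤ 0) : Real.exp (-(c * (t - s))) * u s ≤ u t :=
  exp_mono_aux' c u (fun t => G (u (t - 1))) hu.cont s t hst
    (fun x hx => hu.hd x (by linarith [hx.2])) (fun x _ => (hu.Gnn hc hη hG _).2.2)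

lemma SolAux.decay1 (hc : 0 < c) (hη : 0 < η) (hG : GAux c η P κ G) (hu : SolAux c κ G u)
    {s t : ℝ} (hst : s ≤ t) (hst1 : t ≤ s + 1) (ht : t ≤ 0) : u s ≤ Real.exp c * u t := by
  have h := hu.decay hc hη hG hst ht
  have e1 : Real.exp (-c) ≤ Real.exp (-(c * (t - s))) := by
    apply Real.exp_le_exp.2
    nlinarith
  have h2 : Real.exp (-c) * u s ≤ u t := le_trans (by gcongr; exact hu.nn s) h
  calc u s = Real.exp c * (Real.exp (-c) * u s) := by rw [← mul_assoc, ← Real.exp_add]; simp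
    _ ≤ _ := by gcongr

lemma SolAux.pos (hc : 0 < c) (hη : 0 < η) (hκ : 0 < κ) (hG : GAux c η P κ G)
    (hu : SolAux c κ G u) (t : ℝ) (ht : t ≤ 0) : 0 < u t := by
  by_contra hcon
  have h0 : u t = 0 := le_antisymm (not_lt.1 hcon) (hu.nn t)
  have hcpt : IsCompact (Icc t 0 ∩ u ⁻¹' {0}) :=
    isCompact_Icc.inter_right (isClosed_singleton.preimage hu.cont)
  obtain ⟨m, ⟨hm, hm0⟩, hmax⟩ := hcpt.exists_isGreatest ⟨t, ⟨le_rfl, ht⟩, h0⟩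
  have hm0 : u m = 0 := hm0
  have hmlt : m < 0 := lt_of_le_of_ne hm.2 (by rintro rfl; rw [hu.u0] at hm0; linarith)
  have hz : ∀ s ≤ m, u s = 0 := by
    intro s hs
    have := hu.decay hc hη hG hs hm.2
    rw [hm0] at this
    refine le_antisymm ?_ (hu.nn s)
    by_contra hh
    have := mul_pos (Real.exp_pos (-(c * (m - s)))) (not_le.1 hh)
    linarith
  set e := min (m + 1) 0
  have hme : m < e := lt_min (by linarith) hmlt
  have he0 : e ≤ 0 := min_le_right _ _
  have he1 : e ≤ m + 1 := min_le_left _ _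
  have key := exp_mono_aux' c (fun x => - u x) (fun _ => 0) hu.cont.neg m e hme.le ?_ (by simp)
  · simp only [hm0] at key
    have : u e = 0 := le_antisymm (by linarith) (hu.nn e)
    have := hmax ⟨⟨hm.1.trans hme.le, he0⟩, this⟩
    linarith
  · intro x hx
    have := (hu.hd x (by linarith [hx.2])).neg
    rw [hz (x - 1) (by linarith [hx.2]), hG.zero] at this
    refine this.congr_deriv ?_
    ring

lemma SolAux.tendsto (hc : 0 < c) (hη : 0 < η) (hG : GAux c η P κ G)
    (hu : SolAux c κ G u) : Tendsto u atBot (𝓝 0) := by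
  set I : ℝ → ℝ := fun t => ∫ s in (0:ℝ)..t, u s with hI
  have hId : ∀ t, HasDerivAt I (u t) t := fun t =>
    intervalIntegral.integral_hasDerivAt_right (hu.cont.intervalIntegrable _ _)
      hu.cont.stronglyMeasurable.stronglyMeasurableAtFilter hu.cont.continuousAt
  have hIm : Monotone I := monotone_of_deriv_nonneg (fun t => (hId t).differentiableAt)
    (fun t => by rw [(hId t).deriv]; exact hu.nn t)
  have hId1 : ∀ t, HasDerivAt (fun t => I (t - 1)) (u (t - 1)) t := fun t =>
    (hId (t - 1)).comp_sub_const t 1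
  have hIc : Continuous I := continuous_iff_continuousAt.2 fun t => (hId t).continuousAt
  set V : ℝ → ℝ := fun t => u t + c * (I t - I (t - 1)) - η * I (t - 1) with hV
  have hVd : ∀ t < 0, HasDerivAt V (-c * u t + G (u (t - 1)) + c * (u t - u (t - 1))
      - η * u (t - 1)) t := fun t ht =>
    ((hu.hd t ht).add (((hId t).sub (hId1 t)).const_mul c)).sub ((hId1 t).const_mul η)
  have hVm : MonotoneOn V (Iic 0) := by
    have hVc : Continuous V := by
      have := hu.cont
      fun_prop
    apply monotoneOn_of_deriv_nonneg (convex_Iic 0) hVc.continuousOn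
    · intro x hx
      rw [interior_Iic] at hx
      exact (hVd x hx).differentiableAt.differentiableWithinAt
    · intro x hx
      rw [interior_Iic] at hx
      rw [(hVd x hx).deriv]
      have := (hu.Gnn hc hη hG (x - 1)).1
      linarith
  have hbdd : ∀ t, min (-(V 0 / η)) (I 0) ≤ I t := by
    intro t
    rcases le_total 0 t with h | h
    · exact (min_le_right _ _).trans (hIm h)
    · refine (min_le_left _ _).trans ?_
      have h1 := hVm h (mem_Iic.2 le_rfl) h
      have h2 : I (t - 1) ≤ I t := hIm (by linarith)
      have h3 : - η * I (t - 1) ≤ V 0 := by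
        have : - η * I (t - 1) ≤ V t := by
          have := hu.nn t
          have : 0 ≤ c * (I t - I (t - 1)) := mul_nonneg hc.le (by linarith)
          simp only [hV]; linarith
        linarith
      have h4 : -(V 0 / η) ≤ I (t - 1) := by
        rw [neg_le, ]
        rw [le_div_iff₀ hη]; linarith
      linarith
  have hlim := tendsto_atBot_ciInf hIm ⟨_, by rintro _ ⟨t, rfl⟩; exact hbdd t⟩
  have hlim1 := hlim.comp (tendsto_atBot_add_const_right atBot (1:ℝ) tendsto_id)
  have hd := (hlim1.sub hlim).const_mul (Real.exp c)
  simp only [sub_self, mul_zero] at hd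
  refine tendsto_of_tendsto_of_tendsto_of_le_of_le' tendsto_const_nhds hd
    (Eventually.of_forall hu.nn) ?_
  filter_upwards [eventually_le_atBot (-1:ℝ)] with t ht
  obtain ⟨ξ, hξ, hξe⟩ := exists_hasDerivAt_eq_slope I u (show t < t + 1 by linarith)
    hIc.continuousOn (fun x _ => hId x)
  have h1 : I (t + 1) - I t = u ξ := by rw [hξe]; simp
  show u t ≤ Real.exp c * (I (t + 1) - I t)
  rw [h1]
  exact hu.decay1 hc hη hG hξ.1.le hξ.2.le (by linarith [hξ.2])

lemma SolAux.no_order (hc : 0 < c) (hη : 0 < η) (hG : GAux c η P κ G)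
    (hu : SolAux c κ G u) (hv : SolAux c κ G v) (t : ℝ) (ht : t ≤ 0)
    (h : ∀ s ∈ Icc (t - 1) t, v s < u s) : False := by
  have hcpt : IsCompact (Icc t 0 ∩ {s | u s ≤ v s}) :=
    isCompact_Icc.inter_right (isClosed_le hu.cont hv.cont)
  obtain ⟨m, ⟨hm, hm0⟩, hmin⟩ := hcpt.exists_isLeast
    ⟨0, ⟨ht, le_rfl⟩, by simp [hu.u0, hv.u0]⟩
  have hm0 : u m ≤ v m := hm0
  have hlt : ∀ s, t - 1 ≤ s → s < m → v s < u s := by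
    intro s hs hsm
    rcases le_total s t with h1 | h1
    · exact h s ⟨hs, h1⟩
    · by_contra hh
      have := hmin ⟨⟨h1, hsm.le.trans hm.2⟩, not_lt.1 hh⟩
      linarith
  have key := exp_mono_aux' c (fun x => u x - v x) (fun x => G (u (x - 1)) - G (v (x - 1)))
    (hu.cont.sub hv.cont) t m hm.1 ?_ ?_
  · have := mul_pos (Real.exp_pos (-(c * (m - t)))) (sub_pos.2 (h t ⟨by linarith, le_rfl⟩))
    linarith
  · intro x hx
    have hx0 : x < 0 := by linarith [hx.2, hm.2]
    refine ((hu.hd x hx0).sub (hv.hd x hx0)).congr_deriv ?_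
    ring
  · intro x hx
    have h1 := hlt (x - 1) (by linarith [hx.1]) (by linarith [hx.2])
    have h2 := hG.lo _ _ (hv.nn (x - 1)) h1.le (hu.le _)
    exact le_trans (mul_nonneg (by linarith) (by linarith)) h2

lemma SolAux.zero (hc : 0 < c) (hη : 0 < η) (hG : GAux c η P κ G)
    (hu : SolAux c κ G u) (hv : SolAux c κ G v) (t : ℝ) (ht : t ≤ 0) :
    ∃ t0 ∈ Icc (t - 1) t, u t0 - v t0 = 0 := by
  by_contra hcon
  push Not at hcon
  have hcw : ContinuousOn (fun s => u s - v s) (Icc (t - 1) t) :=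
    (hu.cont.sub hv.cont).continuousOn
  have hpc : IsPreconnected (Icc (t - 1) t) := isPreconnected_Icc
  have htm : t ∈ Icc (t - 1) t := ⟨by linarith, le_rfl⟩
  rcases lt_or_gt_of_ne (hcon t htm) with h | h
  · apply hv.no_order hc hη hG hu t ht
    intro s hs
    by_contra hh
    obtain ⟨x, hx, hx0⟩ := hpc.intermediate_value htm hs hcw
      (show (0:ℝ) ∈ Icc _ _ from ⟨h.le, by linarith⟩)
    exact hcon x hx hx0
  · apply hu.no_order hc hη hG hv t ht
    intro s hs
    by_contra hh
    obtain ⟨x, hx, hx0⟩ := hpc.intermediate_value hs htm hcw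
      (show (0:ℝ) ∈ Icc _ _ from ⟨by linarith, h.le⟩)
    exact hcon x hx hx0

lemma SolAux.upper (hc : 0 < c) (hη : 0 < η) (hG : GAux c η P κ G) (hP : 0 ≤ P)
    (hu : SolAux c κ G u) {s t : ℝ} (hst : s ≤ t) (hst1 : t ≤ s + 1) (ht : t ≤ 0) :
    u t ≤ (1 + P * Real.exp c) * u s := by
  -- `u' ≤ P * exp c * u s` on `[s,t]`
  have key := exp_mono_aux' 0 (fun x => P * Real.exp c * u s * x - u x)
    (fun x => P * Real.exp c * u s - (-c * u x + G (u (x - 1))))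
    (by have := hu.cont; fun_prop) s t hst ?_ ?_
  · simp only [zero_mul, neg_zero, Real.exp_zero, one_mul] at key
    have h0 : 0 ≤ P * Real.exp c * u s := by have := hu.nn s; positivity
    nlinarith
  · intro x hx
    have := ((hasDerivAt_id x).const_mul (P * Real.exp c * u s)).sub (hu.hd x (by linarith [hx.2]))
    refine this.congr_deriv ?_
    ring
  · intro x hx
    have h1 := (hu.Gnn hc hη hG (x - 1)).2.1
    have h2 := hu.decay1 hc hη hG (s := x - 1) (t := s) (by linarith [hx.2]) (by linarith [hx.1])
      (by linarith)
    have h3 : P * u (x - 1) ≤ P * (Real.exp c * u s) := by gcongr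
    have h4 := mul_nonneg hc.le (hu.nn x)
    linarith

lemma SolAux.unique_left (hc : 0 < c) (hη : 0 < η) (hκ : 0 < κ) (hP : 0 ≤ P) (hG : GAux c η P κ G)
    {γ : ℝ} (hγ : 0 < γ)
    (hG0 : ∀ δ > 0, ∃ r > 0, ∀ x y, 0 ≤ x → x ≤ r → 0 ≤ y → y ≤ r → x ≤ κ → y ≤ κ →
      |G x - G y - γ * (x - y)| ≤ δ * |x - y|)
    (hu : SolAux c κ G u) (hv : SolAux c κ G v) : ∃ T ≤ 0, ∀ t ≤ T, u t = v t := by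
  set e := Real.exp (-(Real.exp c * γ)) with he
  have hepos : 0 < e := Real.exp_pos _
  have he1 : e ≤ 1 := Real.exp_le_one_iff.2 (by have := Real.exp_pos c; nlinarith)
  set δ := e * γ / 4 with hδ
  have hδpos : 0 < δ := by positivity
  obtain ⟨r, hr, hGr⟩ := hG0 δ hδpos
  have hev : ∀ᶠ t in atBot, u t < r ∧ v t < r :=
    ((hu.tendsto hc hη hG).eventually_lt_const hr).and
      ((hv.tendsto hc hη hG).eventually_lt_const hr)
  obtain ⟨T0, hT0⟩ := eventually_atBot.1 hev
  set T := min T0 0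
  have hT00 : T ≤ 0 := min_le_right _ _
  have hT : ∀ t ≤ T, u t < r ∧ v t < r := fun t ht => hT0 t (ht.trans (min_le_left _ _))
  refine ⟨T, hT00, ?_⟩
  set θ := 1 - e / 2 with hθ
  have hθe : 1 - e + 2 * δ / γ = θ := by rw [hδ, hθ]; field_simp; ring
  set C := (1 + P * Real.exp c) * Real.exp c + 1 with hC
  -- the positive comparison function must be positive everywhere
  have hit : ∀ n : ℕ, ∀ t ≤ T, |u t - v t| ≤ C * θ ^ n * u t := by
    intro n
    induction n with
    | zero =>
      intro t ht
      obtain ⟨t0, ht0, hw0⟩ := hu.zero hc hη hG hv t (ht.trans hT00)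
      have h1 := hv.upper hc hη hG hP ht0.2 (by linarith [ht0.1]) (ht.trans hT00)
      have h2 := hu.decay1 hc hη hG ht0.2 (by linarith [ht0.1]) (ht.trans hT00)
      have h3 : v t0 = u t0 := by linarith
      rw [h3] at h1
      have h4 : (1 + P * Real.exp c) * u t0 ≤ (1 + P * Real.exp c) * (Real.exp c * u t) := by
        gcongr
      have := hu.nn t
      have := hv.nn t
      have h5 : 0 ≤ (1 + P * Real.exp c) * (Real.exp c * u t) := by positivity
      rw [pow_zero, mul_one, hC, abs_le]
      constructor <;> nlinarith
    | succ n ih =>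
      have hθ0 : 0 ≤ θ := by rw [hθ]; linarith
      have hS : 0 ≤ C * θ ^ n := by positivity
      -- truncated functions
      have hpos : ∀ t, 0 < u (min t 0) := fun t => hu.pos hc hη hκ hG _ (min_le_right _ _)
      have hmin : ∀ t < (0:ℝ), (fun s => min s (0:ℝ)) =ᶠ[𝓝 t] id := by
        intro t ht
        filter_upwards [eventually_lt_nhds ht] with s hs
        exact min_eq_left hs.le
      have hud : ∀ t < T, HasDerivAt (fun s => u (min s 0))
          (-c * u (min t 0) + G (u (t - 1))) t := by
        intro t ht
        have ht0 : t < 0 := by linarith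
        rw [min_eq_left ht0.le]
        refine (hu.hd t ht0).congr_of_eventuallyEq ?_
        exact (hmin t ht0).fun_comp u
      have hα : ∀ t < T, |G (u (t - 1)) - γ * u (min (t - 1) 0)| ≤ δ * u (min (t - 1) 0) := by
        intro t ht
        rw [min_eq_left (by linarith)]
        have := hGr (u (t - 1)) 0 (hu.nn _) (hT (t-1) (by linarith)).1.le le_rfl hr.le (hu.le _) hκ.le
        simpa [hG.zero, abs_of_nonneg (hu.nn _)] using this
      have hβ : ∀ t < T, |(G (u (t - 1)) - G (v (t - 1))) - γ * (u (t - 1) - v (t - 1))|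
          ≤ δ * |u (t - 1) - v (t - 1)| := fun t ht =>
        hGr _ _ (hu.nn _) (hT (t-1) (by linarith)).1.le (hv.nn _) (hT (t-1) (by linarith)).2.le
          (hu.le _) (hv.le _)
      have hk : ∀ t < T, u (min (t - 1) 0) ≤ Real.exp c * u (min t 0) := by
        intro t ht
        rw [min_eq_left (by linarith), min_eq_left (by linarith)]
        exact hu.decay1 hc hη hG (by linarith) (by linarith) (by linarith)
      have huc : Continuous fun s => u (min s 0) := hu.cont.comp (by fun_prop)
      have A := contr_aux c γ δ (C * θ ^ n) T hγ hδpos.le hS (fun s => u (min s 0))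
        (fun s => u s - v s) (fun t => G (u (t - 1))) (fun t => G (u (t - 1)) - G (v (t - 1)))
        huc (hu.cont.sub hv.cont) hpos hud
        (fun t ht => by
          refine ((hu.hd t (by linarith)).sub (hv.hd t (by linarith))).congr_deriv ?_
          ring) hα hβ hk
        (fun t ht => by rw [min_eq_left (by linarith)]; exact ih t ht)
        (fun t ht => hu.zero hc hη hG hv t (by linarith))
      have B := contr_aux c γ δ (C * θ ^ n) T hγ hδpos.le hS (fun s => u (min s 0))
        (fun s => v s - u s) (fun t => G (u (t - 1))) (fun t => G (v (t - 1)) - G (u (t - 1)))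
        huc (hv.cont.sub hu.cont) hpos hud
        (fun t ht => by
          refine ((hv.hd t (by linarith)).sub (hu.hd t (by linarith))).congr_deriv ?_
          ring) hα
        (fun t ht => by
          have := hβ t ht
          rw [abs_sub_comm (v (t - 1))]
          rw [← abs_neg]
          convert this using 2
          ring) hk
        (fun t ht => by rw [min_eq_left (by linarith), abs_sub_comm]; exact ih t ht)
        (fun t ht => hv.zero hc hη hG hu t (by linarith))
      intro t ht
      have a := A t ht
      have b := B t ht
      rw [← he, hθe, min_eq_left (by linarith)] at a b
      rw [pow_succ, ← mul_assoc, abs_le]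
      constructor <;> linarith
  intro t ht
  have hlim : Tendsto (fun n : ℕ => C * θ ^ n * u t) atTop (𝓝 (C * 0 * u t)) :=
    ((tendsto_pow_atTop_nhds_zero_of_lt_one (by rw [hθ]; linarith) (by rw [hθ]; linarith)).const_mul
      C).mul_const _
  have h0 := ge_of_tendsto' hlim (fun n => hit n t ht)
  have : |u t - v t| = 0 := le_antisymm (by simpa using h0) (abs_nonneg _)
  exact sub_eq_zero.1 (abs_eq_zero.1 this)

lemma SolAux.unique (hc : 0 < c) (hη : 0 < η) (hκ : 0 < κ) (hP : 0 ≤ P) (hG : GAux c η P κ G)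
    {γ : ℝ} (hγ : 0 < γ)
    (hG0 : ∀ δ > 0, ∃ r > 0, ∀ x y, 0 ≤ x → x ≤ r → 0 ≤ y → y ≤ r → x ≤ κ → y ≤ κ →
      |G x - G y - γ * (x - y)| ≤ δ * |x - y|)
    (hu : SolAux c κ G u) (hv : SolAux c κ G v) : ∀ t ≤ 0, u t = v t := by
  obtain ⟨T, hT0, hT⟩ := SolAux.unique_left hc hη hκ hP hG hγ hG0 hu hv
  have step : ∀ n : ℕ, ∀ t ≤ 0, t ≤ T + n → u t = v t := by
    intro n
    induction n with
    | zero => intro t _ ht; exact hT t (by simpa using ht)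
    | succ n ih =>
      intro t ht htn
      push_cast at htn
      by_cases hle : t ≤ T
      · exact hT t hle
      push Not at hle
      have hTe : u T = v T := hT T le_rfl
      have hpt : ∀ x ∈ Ioo T t, G (u (x - 1)) = G (v (x - 1)) := fun x hx => by
        rw [ih (x - 1) (by linarith [hx.2]) (by linarith [hx.2])]
      have k1 := exp_mono_aux' c (fun x => u x - v x) (fun x => 0)
        (hu.cont.sub hv.cont) T t hle.le (fun x hx => by
          refine ((hu.hd x (by linarith [hx.2])).sub (hv.hd x (by linarith [hx.2]))).congr_deriv ?_
          rw [hpt x hx]; ring) (by simp)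
      have k2 := exp_mono_aux' c (fun x => v x - u x) (fun x => 0)
        (hv.cont.sub hu.cont) T t hle.le (fun x hx => by
          refine ((hv.hd x (by linarith [hx.2])).sub (hu.hd x (by linarith [hx.2]))).congr_deriv ?_
          rw [hpt x hx]; ring) (by simp)
      simp only [hTe, sub_self, mul_zero] at k1 k2
      linarith
  intro t ht
  obtain ⟨n, hn⟩ := exists_nat_ge (t - T)
  exact step n t ht (by linarith)
end

lemma sol_deriv_aux {a b : ℝ} {F x : ℝ → ℝ} (hx : IsSolR a b F x) {S : Set ℝ}
    (hF : ContinuousOn F S) (hS : ∀ t ≤ 0, x t ∈ S) (t : ℝ) (ht : t < 1) :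
    HasDerivAt x (-a * x t + b * F (x (t - 1))) t := by
  obtain ⟨hc, -, hi⟩ := hx
  set h : ℝ → ℝ := fun s => Real.exp (a * s) * F (x (min (s - 1) 0)) with hh
  have hhc : Continuous h := by
    have : Continuous fun s => F (x (min (s - 1) 0)) :=
      hF.comp_continuous (hc.comp (by fun_prop)) (fun s => hS _ (min_le_right _ _))
    exact (by fun_prop : Continuous fun s : ℝ => Real.exp (a * s)).mul this
  set τ := t - 1 with hτ
  have hId : HasDerivAt (fun r => ∫ s in τ..r, h s) (h t) t :=
    intervalIntegral.integral_hasDerivAt_right (hhc.intervalIntegrable _ _)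
      hhc.stronglyMeasurable.stronglyMeasurableAtFilter hhc.continuousAt
  have hE : HasDerivAt (fun r => Real.exp (-a * r)) (Real.exp (-a * t) * (-a * 1)) t :=
    ((hasDerivAt_id t).const_mul (-a)).exp
  have hform : ∀ r, τ < r → r < 1 →
      x r = Real.exp (-a * r) * (Real.exp (a * τ) * x τ + b * ∫ s in τ..r, h s) := by
    intro r hr hr1
    rw [(hi τ r hr).2]
    have : (∫ s in τ..r, Real.exp (-a * (r - s)) * F (x (s - 1)))
        = Real.exp (-a * r) * ∫ s in τ..r, h s := by
      rw [← intervalIntegral.integral_const_mul]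
      apply intervalIntegral.integral_congr
      intro s hs
      rw [uIcc_of_le hr.le] at hs
      simp only [hh]
      rw [min_eq_left (by linarith [hs.2]), ← mul_assoc, ← Real.exp_add]
      congr 2
      ring
    rw [this, mul_add, ← mul_assoc (Real.exp (-a * r)) (Real.exp (a * τ)), ← Real.exp_add]
    have : -a * (r - τ) = -a * r + a * τ := by ring
    rw [this]; ring
  have hD := hE.mul ((hId.const_mul b).const_add (Real.exp (a * τ) * x τ))
  have hD' : HasDerivAt x _ t := hD.congr_of_eventuallyEq (by
    filter_upwards [Ioo_mem_nhds (show τ < t by linarith) ht] with r hr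
    exact hform r hr.1 hr.2)
  refine hD'.congr_deriv ?_
  have e1 := hform t (by linarith) ht
  have e2 : Real.exp (-a * t) * h t = F (x (t - 1)) := by
    simp only [hh]
    rw [min_eq_left (by linarith), ← mul_assoc, ← Real.exp_add]
    simp
  rw [← hτ] at *
  calc _ = -a * (Real.exp (-a * t) * (Real.exp (a * τ) * x τ + b * ∫ s in τ..t, h s))
        + b * (Real.exp (-a * t) * h t) := by ring
    _ = _ := by rw [← e1, e2]

lemma G_aux {c d : ℝ} {g g' : ℝ → ℝ} (hg : CgA g g') (hc : 0 < c) (hd : 0 < d)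
    {ξ₁ κ : ℝ} (h0 : 0 < ξ₁) (hκ : 0 < κ) (h1 : ξ₁ + κ < 1) (hz : -c * ξ₁ + d * g ξ₁ = 0) :
    ∃ η P γ : ℝ, 0 < η ∧ 0 ≤ P ∧ 0 < γ ∧ GAux c η P κ (fun x => d * g (x + ξ₁) - c * ξ₁) ∧
    (∀ δ > 0, ∃ r > 0, ∀ x y, 0 ≤ x → x ≤ r → 0 ≤ y → y ≤ r → x ≤ κ → y ≤ κ →
      |(d * g (x + ξ₁) - c * ξ₁) - (d * g (y + ξ₁) - c * ξ₁) - γ * (x - y)| ≤ δ * |x - y|) := by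
  have hgd : ∀ ξ ∈ Ioo (0:ℝ) 1, HasDerivAt g (g' ξ) ξ := fun ξ hξ =>
    (hg.hasDeriv ξ (Ioo_subset_Icc_self hξ)).hasDerivAt (Icc_mem_nhds hξ.1 hξ.2)
  have hmono : MonotoneOn (fun ξ => g ξ / ξ) (Ioo 0 1) := by
    have hD : ∀ ξ ∈ Ioo (0:ℝ) 1, HasDerivAt (fun ξ => g ξ / ξ)
        ((g' ξ * ξ - g ξ * 1) / ξ ^ 2) ξ := fun ξ hξ =>
      (hgd ξ hξ).div (hasDerivAt_id ξ) hξ.1.ne'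
    apply monotoneOn_of_deriv_nonneg (convex_Ioo 0 1)
    · exact fun ξ hξ => (hD ξ hξ).continuousAt.continuousWithinAt
    · rw [interior_Ioo]
      exact fun ξ hξ => (hD ξ hξ).differentiableAt.differentiableWithinAt
    · rw [interior_Ioo]
      intro ξ hξ
      rw [(hD ξ hξ).deriv]
      have := (div_lt_iff₀ hξ.1).1 (hg.slope ξ hξ.1 hξ.2.le)
      apply div_nonneg _ (sq_nonneg _)
      linarith
  have hsub : Icc ξ₁ (ξ₁ + κ) ⊆ Ioo 0 1 := fun x hx => ⟨by linarith [hx.1], by linarith [hx.2]⟩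
  have hg'c : ContinuousOn g' (Icc ξ₁ (ξ₁ + κ)) :=
    hg.derivCont.mono (hsub.trans Ioo_subset_Icc_self)
  have hgt : ∀ ξ ∈ Icc ξ₁ (ξ₁ + κ), c < d * g' ξ := by
    intro ξ hξ
    have a1 := hmono (hsub ⟨le_rfl, by linarith⟩) (hsub hξ) hξ.1
    have a2 := hg.slope ξ (hsub hξ).1 (hsub hξ).2.le
    have a3 : c = d * (g ξ₁ / ξ₁) := by field_simp; linarith
    have a4 : g ξ₁ / ξ₁ < g' ξ := lt_of_le_of_lt a1 a2
    rw [a3]; gcongr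
  have hne : (Icc ξ₁ (ξ₁ + κ)).Nonempty := ⟨ξ₁, le_rfl, by linarith⟩
  obtain ⟨p, hp, hpmin⟩ := isCompact_Icc.exists_isMinOn hne hg'c
  obtain ⟨q, hq, hqmax⟩ := isCompact_Icc.exists_isMaxOn hne hg'c
  have hGd : ∀ x ∈ Icc (0:ℝ) κ, HasDerivAt (fun x => d * g (x + ξ₁) - c * ξ₁)
      (d * g' (x + ξ₁)) x := fun x hx =>
    (((hgd (x + ξ₁) (hsub ⟨by linarith [hx.1], by linarith [hx.2]⟩)).comp_add_const x
      ξ₁).const_mul d).sub_const _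
  have hmv : ∀ x y, 0 ≤ x → x < y → y ≤ κ → ∃ z ∈ Icc ξ₁ (ξ₁ + κ),
      (d * g (y + ξ₁) - c * ξ₁) - (d * g (x + ξ₁) - c * ξ₁) = d * g' z * (y - x) := by
    intro x y hx hxy hy
    obtain ⟨z, hz, hze⟩ := exists_hasDerivAt_eq_slope (fun x => d * g (x + ξ₁) - c * ξ₁)
      (fun x => d * g' (x + ξ₁)) hxy
      (fun z hz => (hGd z ⟨hx.trans hz.1, hz.2.trans hy⟩).continuousAt.continuousWithinAt)
      (fun z hz => hGd z ⟨hx.trans hz.1.le, hz.2.le.trans hy⟩)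
    refine ⟨z + ξ₁, ⟨by linarith [hz.1], by linarith [hz.2]⟩, ?_⟩
    have : y - x ≠ 0 := by linarith
    rw [hze]; field_simp
  refine ⟨d * g' p - c, d * g' q, d * g' ξ₁, by linarith [hgt p hp], by linarith [hgt q hq],
    by linarith [hgt ξ₁ ⟨le_rfl, by linarith⟩], ⟨?_, ?_, ?_⟩, ?_⟩
  · simp only [zero_add]; linarith
  · intro x y hx hxy hy
    rcases hxy.eq_or_lt with rfl | hlt
    · simp
    obtain ⟨z, hz, hze⟩ := hmv x y hx hlt hy
    simp only [hze]
    have : g' p ≤ g' z := hpmin hz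
    have h3 : 0 ≤ y - x := by linarith
    have : d * g' p * (y - x) ≤ d * g' z * (y - x) := by gcongr
    linarith
  · intro x y hx hxy hy
    rcases hxy.eq_or_lt with rfl | hlt
    · simp
    obtain ⟨z, hz, hze⟩ := hmv x y hx hlt hy
    simp only [hze]
    have : g' z ≤ g' q := hqmax hz
    have h3 : 0 ≤ y - x := by linarith
    gcongr
  · intro δ hδ
    have hca : ContinuousAt g' ξ₁ :=
      (hg.derivCont).continuousAt (Icc_mem_nhds h0 (by linarith))
    obtain ⟨r, hr, hrb⟩ := Metric.continuousAt_iff.1 hca (δ / d) (by positivity)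
    refine ⟨r / 2, by positivity, ?_⟩
    intro x y hx hxr hy hyr hxκ hyκ
    have hconv : Convex ℝ (Icc (0:ℝ) (min (r/2) κ)) := convex_Icc _ _
    have := hconv.norm_image_sub_le_of_norm_hasDerivWithin_le (C := δ)
      (f := fun x => d * g (x + ξ₁) - c * ξ₁ - d * g' ξ₁ * x)
      (f' := fun x => d * g' (x + ξ₁) - d * g' ξ₁ * 1) (x := y) (y := x)
      (fun z hz => ((hGd z ⟨hz.1, hz.2.trans (min_le_right _ _)⟩).sub
        ((hasDerivAt_id z).const_mul _)).hasDerivWithinAt) ?_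
      ⟨hy, le_min hyr hyκ⟩ ⟨hx, le_min hxr hxκ⟩
    · rw [Real.norm_eq_abs, Real.norm_eq_abs] at this
      refine le_trans (le_of_eq ?_) this
      congr 1; ring
    · intro z hz
      have hz2 := hz.2.trans (min_le_left _ _)
      have := hrb (x := z + ξ₁) (by
        rw [Real.dist_eq, add_sub_cancel_right, abs_of_nonneg hz.1]; linarith)
      rw [Real.dist_eq] at this
      rw [Real.norm_eq_abs, mul_one, ← mul_sub, abs_mul, abs_of_pos hd]
      rw [lt_div_iff₀ hd] at this
      linarith

lemma limit_aux (l : Ultrafilter ℕ) (Z : ℕ → ℝ → ℝ) (A B : ℕ → ℝ) (F : ℕ → ℝ → ℝ) (c d m : ℝ)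
    (g : ℝ → ℝ) (hA : Tendsto A l (𝓝 c)) (hB : Tendsto B l (𝓝 d)) (hm : m ≤ 1)
    (hbd : ∀ᶠ k in (l : Filter ℕ), ∀ t ≤ 0, Z k t ∈ Icc 0 m)
    (hF1 : ∀ᶠ k in (l : Filter ℕ), ∀ ξ ∈ Icc 0 m, |F k ξ| ≤ 1)
    (hFg : ∀ ε > 0, ∀ᶠ k in (l : Filter ℕ), ∀ ξ ∈ Icc 0 m, |F k ξ - g ξ| < ε)
    (hgc : ContinuousOn g (Icc 0 m))
    (hd : ∀ᶠ k in (l : Filter ℕ), ∀ t < 1,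
      HasDerivAt (Z k) (-A k * Z k t + B k * F k (Z k (t - 1))) t) :
    ∃ y : ℝ → ℝ, Continuous y ∧ (∀ t ≤ 0, Tendsto (fun k => Z k t) l (𝓝 (y t))) ∧
      (∀ t < 0, HasDerivAt y (-c * y t + d * g (y (t - 1))) t) ∧
      (∀ ε > 0, ∀ᶠ k in (l : Filter ℕ), ∀ t ∈ Icc (-1:ℝ) 0, |Z k t - y t| < ε) ∧
      ∀ t, y t = y (min t 0) := by
  have hex : ∀ t, ∃ y, t ≤ 0 → Tendsto (fun k => Z k t) l (𝓝 y) := by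
    intro t
    by_cases ht : t ≤ 0
    · have : ((l.map fun k => Z k t) : Filter ℝ) ≤ 𝓟 (Icc 0 m) := by
        rw [le_principal_iff]
        exact hbd.mono fun k hk => hk t ht
      obtain ⟨y, -, hy⟩ := (isCompact_Icc (a := (0:ℝ)) (b := m)).ultrafilter_le_nhds _ this
      exact ⟨y, fun _ => hy⟩
    · exact ⟨0, fun h => absurd h ht⟩
  choose y0 hy0 using hex
  set y : ℝ → ℝ := fun t => y0 (min t 0) with hy
  set W : ℕ → ℝ → ℝ := fun k t => Z k (min t 0) with hW
  have hWy : ∀ t, Tendsto (fun k => W k t) l (𝓝 (y t)) := fun t => hy0 _ (min_le_right _ _)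
  have hWb : ∀ᶠ k in (l : Filter ℕ), ∀ t, W k t ∈ Icc 0 m :=
    hbd.mono fun k hk t => hk _ (min_le_right _ _)
  have hyb : ∀ t, y t ∈ Icc 0 m := fun t =>
    isClosed_Icc.mem_of_tendsto (hWy t) (hWb.mono fun k hk => hk t)
  set K := |c| + 1 + (|d| + 1) with hK
  have hKpos : 0 < K := by positivity
  have hZl : ∀ᶠ k in (l : Filter ℕ), ∀ t s, |W k t - W k s| ≤ K * |t - s| := by
    have eA : ∀ᶠ k in (l : Filter ℕ), |A k| < |c| + 1 :=
      (hA.abs).eventually_lt_const (by linarith)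
    have eB : ∀ᶠ k in (l : Filter ℕ), |B k| < |d| + 1 :=
      (hB.abs).eventually_lt_const (by linarith)
    filter_upwards [eA, eB, hbd, hF1, hd] with k kA kB kb kF kd t s
    have := (convex_Iic (0:ℝ)).norm_image_sub_le_of_norm_hasDerivWithin_le (C := K)
      (f := Z k) (f' := fun t => -A k * Z k t + B k * F k (Z k (t - 1))) (x := min s 0)
      (y := min t 0) (fun z hz => (kd z (by linarith [mem_Iic.1 hz])).hasDerivWithinAt) ?_
      (mem_Iic.2 (min_le_right _ _)) (mem_Iic.2 (min_le_right _ _))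
    · rw [Real.norm_eq_abs, Real.norm_eq_abs] at this
      refine this.trans ?_
      refine mul_le_mul_of_nonneg_left ?_ hKpos.le
      refine (abs_min_sub_min_le_max t 0 s 0).trans ?_
      simp
    · intro z hz
      have hz := mem_Iic.1 hz
      have b1 := kb z hz
      have b2 := kF _ (kb (z - 1) (by linarith))
      have b3 : |Z k z| ≤ 1 := by rw [abs_of_nonneg b1.1]; exact b1.2.trans hm
      rw [Real.norm_eq_abs]
      calc _ ≤ |-A k * Z k z| + |B k * F k (Z k (z - 1))| := abs_add_le _ _
        _ = |A k| * |Z k z| + |B k| * |F k (Z k (z - 1))| := by rw [abs_mul, abs_mul, abs_neg]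
        _ ≤ (|c| + 1) * 1 + (|d| + 1) * 1 := by gcongr
        _ = K := by rw [hK]; ring
  have hyl : ∀ t s, |y t - y s| ≤ K * |t - s| := fun t s =>
    le_of_tendsto ((hWy t).sub (hWy s)).abs (hZl.mono fun k hk => hk t s)
  have hyc : Continuous y := by
    refine (LipschitzWith.of_dist_le_mul (K := ⟨K, hKpos.le⟩) fun t s => ?_).continuous
    rw [Real.dist_eq, Real.dist_eq]; exact hyl t s
  have hunif : ∀ p q : ℝ, ∀ ε > 0, ∀ᶠ k in (l : Filter ℕ), ∀ t ∈ Icc p q, |W k t - y t| < ε := by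
    intro p q ε hε
    have : TendstoLocallyUniformlyOn W y l (Icc p q) := by
      rw [Metric.tendstoLocallyUniformlyOn_iff]
      intro ε hε x hx
      refine ⟨Metric.ball x (ε / (4 * K)), mem_nhdsWithin_of_mem_nhds
        (Metric.ball_mem_nhds _ (by positivity)), ?_⟩
      have e1 : ∀ᶠ k in (l : Filter ℕ), |W k x - y x| < ε / 2 := by
        have := (Metric.tendsto_nhds.1 (hWy x)) (ε / 2) (by positivity)
        simpa only [Real.dist_eq] using this
      filter_upwards [e1, hZl] with k k1 k2 z hz
      rw [Metric.mem_ball, Real.dist_eq, lt_div_iff₀ (by positivity)] at hz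
      have j1 := k2 x z
      have j2 := hyl z x
      rw [abs_sub_comm x z] at j1
      rw [Real.dist_eq]
      have : y z - W k z = (y z - y x) + -(W k x - y x) + (W k x - W k z) := by ring
      calc _ ≤ |y z - y x| + |-(W k x - y x)| + |W k x - W k z| := by
            rw [this]; exact abs_add_three _ _ _
        _ < ε := by rw [abs_neg]; linarith
    rw [tendstoLocallyUniformlyOn_iff_tendstoUniformlyOn_of_compact isCompact_Icc,
      Metric.tendstoUniformlyOn_iff] at this
    filter_upwards [this ε hε] with k hk t ht
    rw [abs_sub_comm, ← Real.dist_eq]; exact hk t ht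
  refine ⟨y, hyc, ?_, ?_, ?_, ?_⟩
  · intro t ht
    simp only [hy, min_eq_left ht]; exact hy0 t ht
  · intro t ht
    refine hasDerivAt_of_tendstoUniformlyOn (l := (l : Filter ℕ)) (s := Ioo (t - 1) 0)
      (f := W) (f' := fun k x => -A k * W k x + B k * F k (W k (x - 1)))
      (g' := fun x => -c * y x + d * g (y (x - 1))) isOpen_Ioo ?_ ?_
      (fun x _ => hWy x) ⟨by linarith, ht⟩
    · rw [Metric.tendstoUniformlyOn_iff]
      intro ε hε
      set e := ε / (3 + |c| + 2 * |d|) with he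
      have hepos : 0 < e := by positivity
      have hee : e * (3 + |c| + 2 * |d|) = ε := by rw [he]; field_simp
      have huc := isCompact_Icc.uniformContinuousOn_of_continuous hgc
      obtain ⟨ρ, hρ, hρg⟩ := Metric.uniformContinuousOn_iff.1 huc e hepos
      have eA : ∀ᶠ k in (l : Filter ℕ), |A k - c| < e := by
        simpa only [Real.dist_eq] using (Metric.tendsto_nhds.1 hA) e hepos
      have eB : ∀ᶠ k in (l : Filter ℕ), |B k - d| < e := by
        simpa only [Real.dist_eq] using (Metric.tendsto_nhds.1 hB) e hepos
      filter_upwards [eA, eB, hunif (t - 2) 0 (min e ρ) (lt_min hepos hρ), hWb, hF1, hFg e hepos]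
        with k k1 k2 k3 k4 k5 k6 x hx
      have w1 := (k3 x ⟨by linarith [hx.1], hx.2.le⟩).trans_le (min_le_left _ _)
      have w2 := (k3 (x - 1) ⟨by linarith [hx.1], by linarith [hx.2]⟩).trans_le (min_le_right _ _)
      have g1 := hρg _ (k4 (x - 1)) _ (hyb (x - 1)) (by rw [Real.dist_eq]; exact w2)
      rw [Real.dist_eq] at g1
      have g2 := k6 _ (k4 (x - 1))
      have g3 := k5 _ (k4 (x - 1))
      have g4 : |W k x| ≤ 1 := by rw [abs_of_nonneg (k4 x).1]; exact (k4 x).2.trans hm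
      rw [dist_comm, Real.dist_eq]
      set f1 := F k (W k (x - 1))
      set w1 := g (W k (x - 1))
      have : -A k * W k x + B k * f1 - (-c * y x + d * g (y (x - 1)))
        = (-(A k - c) * W k x + -c * (W k x - y x)) +
          ((B k - d) * f1 + (d * (f1 - w1) + d * (w1 - g (y (x - 1))))) := by ring
      calc _ ≤ (|A k - c| * |W k x| + |c| * |W k x - y x|) +
          (|B k - d| * |f1| + (|d| * |f1 - w1| + |d| * |w1 - g (y (x - 1))|)) := by
            rw [this]
            simp only [← abs_mul]
            refine (abs_add_le _ _).trans (add_le_add ?_ ?_)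
            · refine (abs_add_le _ _).trans (le_of_eq ?_)
              rw [neg_mul, abs_neg, neg_mul, abs_neg]
            · refine (abs_add_le _ _).trans (add_le_add le_rfl (abs_add_le _ _))
        _ ≤ (e * 1 + |c| * e) + (e * 1 + (|d| * e + |d| * e)) := by gcongr
        _ < ε := by rw [← hee]; linarith
    · filter_upwards [hd] with k hk x hx
      have hx0 := hx.2
      have e1 : W k x = Z k x := by simp only [hW, min_eq_left hx0.le]
      have e2 : W k (x - 1) = Z k (x - 1) := by
        simp only [hW]; rw [min_eq_left (by linarith)]
      rw [e1, e2]
      refine (hk x (by linarith)).congr_of_eventuallyEq ?_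
      filter_upwards [eventually_lt_nhds hx0] with s hs
      simp only [hW, min_eq_left hs.le]
  · intro ε hε
    filter_upwards [hunif (-1) 0 ε hε] with k hk t ht
    have := hk t ht
    simpa only [hW, min_eq_left ht.2] using this
  · intro t
    simp only [hy]
    rw [min_assoc, min_self]

/-- under condition `(Y_n)`, the initial segments of the solutions
`Y^{+,n,j}` converge to that of `x⁺`, uniformly in `j ∈ J_n`. -/
theorem stmt_17 {ι : Type*} (c d : ℝ) (g g' : ℝ → ℝ) (hg : CgA g g')
    (hc : 0 < c) (hcd : c < d)
    (a b : ℕ → ℝ) (f f' : ℕ → ℝ → ℝ) (hf : Cfn c d g g' a b f f')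
    (ξ₁ : ℝ) (hξ₁ : ξ₁ ∈ Ioo (0:ℝ) 1) (hz₁ : -c * ξ₁ + d * g ξ₁ = 0)
    (κp : ℝ) (hκp : κp ∈ Ioo 0 (1 - ξ₁))
    (ξ1n : ℕ → ℝ) (hξ1n : Tendsto ξ1n atTop (nhds ξ₁))
    (hξ1nz : ∀ᶠ n in atTop, 0 < ξ1n n ∧ -a n * ξ1n n + b n * f n (ξ1n n) = 0)
    (xp : ℝ → ℝ) (hxp : IsSolR c d g xp) (hxp0 : xp 0 = ξ₁ + κp)
    (hxpb : ∀ t : ℝ, t ≤ 0 → ξ₁ ≤ xp t ∧ xp t ≤ xp 0)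
    (ε : ℕ → ℝ) (hε : ∀ n, 0 ≤ ε n) (hεlim : Tendsto ε atTop (nhds 0))
    (J : ℕ → Set ι) (Y : ℕ → ι → ℝ → ℝ)
    (hY : ∀ n, ∀ j ∈ J n, IsSolR (a n) (b n) (f n) (Y n j))
    (hY0 : ∀ n, ∀ j ∈ J n, Y n j 0 = κp + ξ1n n)
    (hYb : ∀ n, ∀ j ∈ J n, ∀ t : ℝ, t < 0 →
        ξ1n n - ε n ≤ Y n j t ∧ Y n j t ≤ κp + ξ1n n) :
    ∀ δ : ℝ, 0 < δ → ∃ N : ℕ, ∀ n ≥ N, ∀ j ∈ J n,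
      ∀ s ∈ Icc (-1:ℝ) 0, |Y n j s - xp s| < δ := by

  intro δ hδ
  by_contra hcon
  push Not at hcon
  choose nn hnn jj hjj ss hss hbad using hcon
  have hntop : Tendsto nn atTop atTop := tendsto_atTop_mono hnn tendsto_id
  set l : Ultrafilter ℕ := Ultrafilter.of atTop with hl
  have hln : Tendsto nn l atTop := hntop.mono_left (Ultrafilter.of_le _)
  obtain ⟨h0, h1⟩ := hξ₁
  obtain ⟨hκ0, hκ1⟩ := hκp
  set m := (1 + (ξ₁ + κp)) / 2 with hm
  have hm1 : m < 1 := by rw [hm]; linarith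
  have hm2 : ξ₁ + κp < m := by rw [hm]; linarith
  have hm0 : 0 < m := by linarith
  have hgc : ContinuousOn g (Icc 0 1) := fun x hx => (hg.hasDeriv x hx).continuousWithinAt
  have hfc : ∀ n, ContinuousOn (f n) (Ici 0) := fun n x hx =>
    (hf.hasDeriv n x hx).continuousWithinAt
  have hlow : Tendsto (fun k => ξ1n (nn k) - ε (nn k)) l (𝓝 ξ₁) := by
    simpa using (hξ1n.comp hln).sub (hεlim.comp hln)
  have hup : Tendsto (fun k => κp + ξ1n (nn k)) l (𝓝 (ξ₁ + κp)) := by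
    rw [add_comm]; exact (hξ1n.comp hln).const_add κp
  have hYb' : ∀ k, ∀ t ≤ 0, ξ1n (nn k) - ε (nn k) ≤ Y (nn k) (jj k) t ∧
      Y (nn k) (jj k) t ≤ κp + ξ1n (nn k) := by
    intro k t ht
    rcases ht.eq_or_lt with rfl | h
    · rw [hY0 _ _ (hjj k)]
      exact ⟨by linarith [hε (nn k)], le_rfl⟩
    · exact hYb _ _ (hjj k) t h
  obtain ⟨y, hyc, hyt, hyd, hyu, hym⟩ := limit_aux l (fun k => Y (nn k) (jj k))
    (fun k => a (nn k)) (fun k => b (nn k)) (fun k => f (nn k)) c d m g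
    (hf.a_lim.comp hln) (hf.b_lim.comp hln) hm1.le
    (by
      filter_upwards [hup.eventually_lt_const hm2] with k k2 t ht
      exact ⟨(hY _ _ (hjj k)).2.1 t, (hYb' k t ht).2.trans k2.le⟩)
    (Eventually.of_forall fun k ξ hξ => by
      have := hf.maps_to (nn k) ξ hξ.1
      rw [abs_of_nonneg this.1]; exact this.2.le)
    (by
      intro e he
      obtain ⟨N, hN⟩ := hf.close (1 - m) (by linarith) (by linarith) e he
      filter_upwards [hln.eventually_ge_atTop N] with k hk ξ hξ
      have := hN (nn k) hk ξ (Or.inl ⟨hξ.1, by linarith [hξ.2]⟩)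
      linarith [abs_nonneg (f' (nn k) ξ - g' ξ)])
    (hgc.mono (Icc_subset_Icc_right hm1.le))
    (Eventually.of_forall fun k t ht =>
      sol_deriv_aux (hY _ _ (hjj k)) (hfc (nn k)) (fun s _ => (hY _ _ (hjj k)).2.1 s) t ht)
  obtain ⟨η, P, γ, hη, hP, hγ, hG, hG0⟩ := G_aux hg hc (hc.trans hcd) h0 hκ0
    (show ξ₁ + κp < 1 by linarith) hz₁
  have hu : SolAux c κp (fun x => d * g (x + ξ₁) - c * ξ₁) (fun t => y t - ξ₁) := by
    refine ⟨by fun_prop, ?_, ?_, ?_, ?_⟩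
    · intro t
      rw [hym t]
      have := le_of_tendsto_of_tendsto' hlow (hyt _ (min_le_right t 0))
        (fun k => (hYb' k _ (min_le_right t 0)).1)
      linarith
    · intro t
      rw [hym t]
      have := le_of_tendsto_of_tendsto' (hyt _ (min_le_right t 0)) hup
        (fun k => (hYb' k _ (min_le_right t 0)).2)
      linarith
    · have h2 := hyt 0 le_rfl
      simp only [hY0 _ _ (hjj _)] at h2
      have := tendsto_nhds_unique h2 hup
      rw [this]; ring
    · intro t ht
      refine ((hyd t ht).sub_const ξ₁).congr_deriv ?_
      simp only [sub_add_cancel]; ring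
  have hv : SolAux c κp (fun x => d * g (x + ξ₁) - c * ξ₁) (fun t => xp (min t 0) - ξ₁) := by
    have := hxp.1
    refine ⟨by fun_prop, ?_, ?_, ?_, ?_⟩
    · intro t
      linarith [(hxpb _ (min_le_right t 0)).1]
    · intro t
      linarith [(hxpb _ (min_le_right t 0)).2]
    · simp only [min_self, hxp0]; ring
    · intro t ht
      have hD := (sol_deriv_aux hxp hgc (fun s hs => ⟨hxp.2.1 s, by
        linarith [(hxpb s hs).2]⟩) t (by linarith)).sub_const ξ₁
      have hD2 : HasDerivAt (fun t => xp (min t 0) - ξ₁) _ t := hD.congr_of_eventuallyEq (by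
        filter_upwards [eventually_lt_nhds ht] with s hs
        rw [min_eq_left hs.le])
      refine hD2.congr_deriv ?_
      simp only [sub_add_cancel]
      rw [min_eq_left ht.le, min_eq_left (by linarith)]; ring
  have heq := SolAux.unique hc hη hκ0 hP hG hγ hG0 hu hv
  obtain ⟨k, hk⟩ := (hyu δ hδ).exists
  have h3 := hk (ss k) (hss k)
  have h4 := heq (ss k) (hss k).2
  rw [min_eq_left (hss k).2] at h4
  have h5 : y (ss k) = xp (ss k) := by linarith
  rw [h5] at h3
  exact absurd h3 (not_lt.2 (hbad k))
end
end
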